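/- arXiv:1511.01741 — 5 statements merged into one kernel-verified Lean document; each statement's English description precedes it below -/
import Mathlib

section
/- Let X be a finite set and k a field. The k-linear span, inside the monoid algebra 𝓡_X = k[𝓒(X,X)], of the set of inessential relations on X is a two-sided ideal I_X of 𝓡_X, and it equals the sum Σ_{|Y|<|X|} k𝓒(X,Y)·k𝓒(Y,X) of the spans of all products of correspondences through sets Y of cardinality strictly smaller than |X|. -/
/-- Composition of correspondences: `rcomp R S = {(z,x) | ∃ y, (z,y) ∈ R ∧ (y,x) ∈ S}`. -/
def rcomp {α β γ : Type*} (R : Set (γ × β)) (S : Set (β × α)) : Set (γ × α) :=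
  {p | ∃ y, (p.1, y) ∈ R ∧ (y, p.2) ∈ S}

/-- The diagonal relation. -/
def diag (X : Type*) : Set (X × X) := {p | p.1 = p.2}

theorem rcomp_assoc {α β γ δ : Type*} (R : Set (δ × γ)) (S : Set (γ × β)) (T : Set (β × α)) :
    rcomp (rcomp R S) T = rcomp R (rcomp S T) := by
  ext ⟨z, x⟩
  constructor
  · rintro ⟨y, ⟨w, hw1, hw2⟩, hy⟩
    exact ⟨w, hw1, y, hw2, hy⟩
  · rintro ⟨w, hw, y, hy1, hy2⟩
    exact ⟨y, ⟨w, hw, hy1⟩, hy2⟩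

theorem diag_rcomp {α β : Type*} (R : Set (β × α)) : rcomp (diag β) R = R := by
  ext ⟨z, x⟩
  simp [rcomp, diag]

theorem rcomp_diag {α β : Type*} (R : Set (β × α)) : rcomp R (diag α) = R := by
  ext ⟨z, x⟩
  simp [rcomp, diag]

/-- The monoid of all relations on `X` under composition of correspondences,
with identity the diagonal. -/
instance relMonoid (X : Type*) : Monoid (Set (X × X)) where
  mul := rcomp
  one := diag X
  mul_assoc := rcomp_assoc
  one_mul := diag_rcomp
  mul_one := rcomp_diag

/-- A relation `R` on `X` is inessential if it factors as `R = S ∘ T` through some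
finite set `Y` with `|Y| < |X|`. -/
def Inessential (X : Type) [Fintype X] (R : Set (X × X)) : Prop :=
  ∃ (Y : Type) (iY : Fintype Y) (S : Set (X × Y)) (T : Set (Y × X)),
    @Fintype.card Y iY < Fintype.card X ∧ R = rcomp S T

theorem Inessential.rcomp_left {X : Type} [Fintype X] {R : Set (X × X)} (hR : Inessential X R)
    (Q : Set (X × X)) : Inessential X (rcomp Q R) := by
  obtain ⟨Y, iY, S, T, hY, rfl⟩ := hR
  exact ⟨Y, iY, rcomp Q S, T, hY, (rcomp_assoc Q S T).symm⟩

theorem Inessential.rcomp_right {X : Type} [Fintype X] {R : Set (X × X)} (hR : Inessential X R)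
    (Q : Set (X × X)) : Inessential X (rcomp R Q) := by
  obtain ⟨Y, iY, S, T, hY, rfl⟩ := hR
  exact ⟨Y, iY, S, rcomp T Q, hY, rcomp_assoc S T Q⟩

/-- A composite through `Y` is a composite through any type equivalent to `Y`. -/
theorem rcomp_eq_rcomp_preimage_equiv {α β β' γ : Type*} (e : β' ≃ β) (S : Set (γ × β))
    (T : Set (β × α)) :
    rcomp S T = rcomp (Prod.map id e ⁻¹' S) (Prod.map e id ⁻¹' T) := by
  ext ⟨z, x⟩
  exact (e.exists_congr_right (q := fun y => (z, y) ∈ S ∧ (y, x) ∈ T)).symm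

theorem inessential_iff_exists_fin {X : Type} [Fintype X] {R : Set (X × X)} :
    Inessential X R ↔ ∃ m < Fintype.card X, ∃ (S : Set (X × Fin m)) (T : Set (Fin m × X)),
      R = rcomp S T := by
  constructor
  · rintro ⟨Y, iY, S, T, hY, rfl⟩
    exact ⟨_, hY, _, _, rcomp_eq_rcomp_preimage_equiv (Fintype.equivFin Y).symm S T⟩
  · rintro ⟨m, hm, S, T, rfl⟩
    exact ⟨Fin m, inferInstance, S, T, by rwa [Fintype.card_fin], rfl⟩

/-- The span of a set of monoid elements closed under multiplication by the monoid on both sides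
is closed under multiplication by the monoid algebra on both sides. -/
theorem MonoidAlgebra.mul_mem_span_of {k M : Type*} [CommSemiring k] [Monoid M] {p : M → Prop}
    (hl : ∀ m n, p n → p (m * n)) (hr : ∀ m n, p n → p (n * m)) (a : MonoidAlgebra k M)
    {x : MonoidAlgebra k M}
    (hx : x ∈ Submodule.span k {x | ∃ m, p m ∧ x = MonoidAlgebra.of k M m}) :
    a * x ∈ Submodule.span k {x | ∃ m, p m ∧ x = MonoidAlgebra.of k M m} ∧
    x * a ∈ Submodule.span k {x | ∃ m, p m ∧ x = MonoidAlgebra.of k M m} := by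
  induction hx using Submodule.span_induction with
  | zero => simp
  | add x y _ _ hx hy =>
    rw [mul_add, add_mul]
    exact ⟨add_mem hx.1 hy.1, add_mem hx.2 hy.2⟩
  | smul c x _ hx =>
    rw [mul_smul_comm, smul_mul_assoc]
    exact ⟨Submodule.smul_mem _ c hx.1, Submodule.smul_mem _ c hx.2⟩
  | mem x hx =>
    obtain ⟨n, hn, rfl⟩ := hx
    induction a using MonoidAlgebra.induction_on with
    | of m =>
      rw [← map_mul, ← map_mul]
      exact ⟨Submodule.subset_span ⟨_, hl m n hn, rfl⟩,
        Submodule.subset_span ⟨_, hr m n hn, rfl⟩⟩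
    | add a b ha hb =>
      rw [mul_add, add_mul]
      exact ⟨add_mem ha.1 hb.1, add_mem ha.2 hb.2⟩
    | smul c a ha =>
      rw [mul_smul_comm, smul_mul_assoc]
      exact ⟨Submodule.smul_mem _ c ha.1, Submodule.smul_mem _ c ha.2⟩

/-- The `k`-linear span, inside the monoid algebra `𝓡_X = k[𝓒(X,X)]`, of the set of
inessential relations on `X` is a two-sided ideal of `𝓡_X`, and it equals the sum
`Σ_{|Y| < |X|} k𝓒(X,Y)·k𝓒(Y,X)` of the spans of all products of correspondences
through sets of cardinality strictly smaller than `|X|`. -/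
theorem span_inessential_two_sided_ideal_eq_sum (k : Type) [Field k] (X : Type) [Fintype X]
    (I : Submodule k (MonoidAlgebra k (Set (X × X))))
    (hI : I = Submodule.span k {x : MonoidAlgebra k (Set (X × X)) |
      ∃ R : Set (X × X), Inessential X R ∧ x = MonoidAlgebra.of k (Set (X × X)) R}) :
    (∀ a : MonoidAlgebra k (Set (X × X)), ∀ x ∈ I, a * x ∈ I ∧ x * a ∈ I) ∧
    I = ⨆ (m : ℕ) (_ : m < Fintype.card X),
      Submodule.span k {x : MonoidAlgebra k (Set (X × X)) |
        ∃ (S : Set (X × Fin m)) (T : Set (Fin m × X)),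
          x = MonoidAlgebra.of k (Set (X × X)) (rcomp S T)} := by
  subst hI
  refine ⟨fun a x hx => MonoidAlgebra.mul_mem_span_of
    (fun Q R hR => hR.rcomp_left Q) (fun Q R hR => hR.rcomp_right Q) a hx, le_antisymm ?_ ?_⟩
  · rw [Submodule.span_le]
    rintro _ ⟨R, hR, rfl⟩
    obtain ⟨m, hm, S, T, rfl⟩ := inessential_iff_exists_fin.1 hR
    exact Submodule.mem_iSup_of_mem m
      (Submodule.mem_iSup_of_mem hm (Submodule.subset_span ⟨S, T, rfl⟩))
  · refine iSup₂_le fun m hm => Submodule.span_mono ?_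
    rintro _ ⟨S, T, rfl⟩
    exact ⟨_, inessential_iff_exists_fin.2 ⟨m, hm, S, T, rfl⟩, rfl⟩
end

section
/- Let k be a field of characteristic different from 2 and X a set with two elements. Then the 16-dimensional monoid algebra 𝓡_X = k𝓒(X,X) of the monoid of relations on X is a semisimple k-algebra; equivalently, its Jacobson radical is zero. -/
/-- Two-by-two Boolean matrices, stored row by row. -/
structure BoolMat where
  (a b c d : Bool)
  deriving DecidableEq, Fintype

namespace BoolMat

/-- The action of a Boolean matrix on Boolean column vectors. -/
def act (m : BoolMat) (v : Bool × Bool) : Bool × Bool :=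
  (m.a && v.1 || m.b && v.2, m.c && v.1 || m.d && v.2)

/-- The entries of a Boolean matrix. -/
def entry (m : BoolMat) (i j : Fin 2) : Bool :=
  ![![m.a, m.b], ![m.c, m.d]] i j

/-- The Boolean matrix with given entries. -/
def ofEntries (f : Fin 2 → Fin 2 → Bool) : BoolMat := ⟨f 0 0, f 0 1, f 1 0, f 1 1⟩

instance : Monoid BoolMat where
  mul m n := ofEntries fun i j ↦ m.entry i 0 && n.entry 0 j || m.entry i 1 && n.entry 1 j
  one := ofEntries fun i j ↦ i = j
  mul_assoc := by decide +kernel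
  one_mul := by decide +kernel
  mul_one := by decide +kernel

/-- The nonzero Boolean column vectors. -/
def nonzeroVec : Fin 3 → Bool × Bool := ![(true, false), (false, true), (true, true)]

/-- A Boolean matrix contains a permutation matrix. -/
def ContainsPerm (m : BoolMat) : Prop := (m.a && m.d || m.b && m.c) = true

instance : DecidablePred ContainsPerm := fun m ↦
  inferInstanceAs (Decidable ((m.a && m.d || m.b && m.c) = true))

/-- The transposition. -/
def swap : BoolMat := ⟨false, true, true, false⟩

/-- The linear character of Boolean matrices which extends by zero the trivial (`ε = 1`) or the
sign (`ε = -1`) character of the group of permutation matrices. -/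
def permChar (ε : ℤˣ) : BoolMat →* ℤ where
  toFun m := if m = 1 then 1 else if m = swap then ε else 0
  map_one' := rfl
  map_mul' := by revert ε; decide +kernel

/-- The two-dimensional representation, which vanishes on matrices not containing a permutation
matrix. -/
def rep₂ : BoolMat →* Matrix (Fin 2) (Fin 2) ℤ where
  toFun m := .of fun i j ↦ if m.ContainsPerm ∧ m.entry i (1 - j) = false then 1 else 0
  map_one' := by decide +kernel
  map_mul' := by decide +kernel

/-- The three-dimensional representation, permuting the nonzero Boolean vectors. -/
def rep₃ : BoolMat →* Matrix (Fin 3) (Fin 3) ℤ where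
  toFun m := .of fun i j ↦ if m.act (nonzeroVec j) = nonzeroVec i then 1 else 0
  map_one' := by decide +kernel
  map_mul' := by decide +kernel

variable (k : Type*) [Field k]

/-- The product of the irreducible representations of the monoid of Boolean matrices. -/
def rep : BoolMat →* k × k × k × Matrix (Fin 2) (Fin 2) k × Matrix (Fin 3) (Fin 3) k :=
  let φ := Int.castRingHom k
  (1 : BoolMat →* k).prod <| ((φ : ℤ →* k).comp (permChar 1)).prod <|
    ((φ : ℤ →* k).comp (permChar (-1))).prod <|
    (φ.mapMatrix.toMonoidHom.comp rep₂).prod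
    (φ.mapMatrix.toMonoidHom.comp rep₃)

theorem sum_smul_rep_eq_zero (hk : (2 : k) ≠ 0) (c : BoolMat → k)
    (h : ∑ m, c m • rep k m = 0) : c = 0 := by
  have h₀ : ∑ m, c m = 0 := by
    simpa [rep, Prod.fst_sum] using congrArg (·.1) h
  have h₁ : ∑ m, c m * (permChar 1 m : ℤ) = 0 := by
    simpa [rep, Prod.fst_sum, Prod.snd_sum] using congrArg (·.2.1) h
  have h₂ : ∑ m, c m * (permChar (-1) m : ℤ) = 0 := by
    simpa [rep, Prod.fst_sum, Prod.snd_sum] using congrArg (·.2.2.1) h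
  have h₃ (i j) : ∑ m, c m * (rep₂ m i j : ℤ) = 0 := by
    simpa [rep, Prod.fst_sum, Prod.snd_sum, Matrix.sum_apply] using congrArg (·.2.2.2.1 i j) h
  have h₄ (i j) : ∑ m, c m * (rep₃ m i j : ℤ) = 0 := by
    simpa [rep, Prod.fst_sum, Prod.snd_sum, Matrix.sum_apply] using congrArg (·.2.2.2.2 i j) h
  let e : Bool × Bool × Bool × Bool ≃ BoolMat :=
    { toFun p := ⟨p.1, p.2.1, p.2.2.1, p.2.2.2⟩
      invFun m := (m.a, m.b, m.c, m.d) }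
  simp only [← e.sum_comp, Fintype.sum_prod_type, Fintype.sum_bool, e, Equiv.coe_fn_mk]
    at h₀ h₁ h₂ h₃ h₄
  have one_eq : (1 : BoolMat) = ⟨true, false, false, true⟩ := rfl
  simp [permChar, swap, one_eq] at h₁ h₂
  simp [rep₂, Fin.forall_fin_succ, ContainsPerm, entry] at h₃
  simp [rep₃, Fin.forall_fin_succ, act, nonzeroVec] at h₄
  ext ⟨x, y, z, w⟩
  cases x <;> cases y <;> cases z <;> cases w <;> simp only [Pi.zero_apply] <;> grind

end BoolMat

/-- Relations on a two-element set are Boolean matrices. -/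
noncomputable def relEquivBoolMat {X : Type*} (e : X ≃ Fin 2) : Set (X × X) ≃* BoolMat where
  toFun R := .ofEntries fun i j ↦ by classical exact decide ((e.symm i, e.symm j) ∈ R)
  invFun m := {p | m.entry (e p.1) (e p.2) = true}
  left_inv R := by
    ext ⟨x, y⟩
    obtain ⟨i, rfl⟩ := e.symm.surjective x
    obtain ⟨j, rfl⟩ := e.symm.surjective y
    fin_cases i <;> fin_cases j <;> simp [BoolMat.entry, BoolMat.ofEntries]
  right_inv m := by simp [BoolMat.entry, BoolMat.ofEntries]
  map_mul' R S := by
    classical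
    have h (x z) : (x, z) ∈ R * S ↔ ∃ i, (x, e.symm i) ∈ R ∧ (e.symm i, z) ∈ S :=
      e.symm.exists_congr_right.symm
    change BoolMat.ofEntries _ = BoolMat.ofEntries _
    congr! 3 with i j
    fin_cases i <;> fin_cases j <;>
    simp [h, Fin.exists_fin_two, BoolMat.entry, BoolMat.ofEntries]

/-- For a two-element set `X` and a field `k` of characteristic different from 2, the
16-dimensional algebra of relations `𝓡_X = k𝓒(X,X)` is a semisimple `k`-algebra;
equivalently, its Jacobson radical is zero. -/
theorem relAlgebra_card_two_semisimple (k : Type) [Field k] (hk : ringChar k ≠ 2)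
    (X : Type) [Fintype X] (hX : Fintype.card X = 2) :
    Module.finrank k (MonoidAlgebra k (Set (X × X))) = 16 ∧
    IsSemisimpleRing (MonoidAlgebra k (Set (X × X))) ∧
    Ideal.jacobson (⊥ : Ideal (MonoidAlgebra k (Set (X × X)))) = ⊥ := by
  let e := MonoidAlgebra.domCongr k k (relEquivBoolMat (Fintype.equivFinOfCardEq hX))
  let f := MonoidAlgebra.lift k _ BoolMat (BoolMat.rep k)
  have hdim : Module.finrank k (MonoidAlgebra k BoolMat) = 16 := by
    rw [Module.finrank_eq_card_basis (MonoidAlgebra.basis BoolMat k)]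
    rfl
  have hf : Function.Injective f := by
    rw [injective_iff_map_eq_zero]
    intro x hx
    rw [MonoidAlgebra.lift_apply, Finsupp.sum_fintype _ _ (by simp)] at hx
    ext m
    exact congrFun (BoolMat.sum_smul_rep_eq_zero k (Ring.two_ne_zero hk) _ hx) m
  have : Module.Finite k (MonoidAlgebra k BoolMat) := .of_basis (MonoidAlgebra.basis BoolMat k)
  have hf' : Function.Bijective f := ⟨hf,
    (LinearMap.injective_iff_surjective_of_finrank_eq_finrank (f := f.toLinearMap)
      (by simp [hdim, Module.finrank_matrix])).1 hf⟩
  have : IsSemisimpleRing (MonoidAlgebra k (Set (X × X))) :=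
    (e.trans (AlgEquiv.ofBijective f hf')).symm.toRingEquiv.isSemisimpleRing
  exact ⟨e.toLinearEquiv.finrank_eq.trans hdim, this,
    Ideal.jacobson_bot.trans (IsSemisimpleRing.jacobson_eq_bot _)⟩
end

section
/- Let k be an algebraically closed field of characteristic different from 2 and X a set with two elements. Then the monoid algebra 𝓡_X = k𝓒(X,X) of the monoid of relations on X is isomorphic, as a k-algebra, to k × k × k × M₂(k) × M₃(k), where M₂(k) and M₃(k) are the algebras of 2×2 and 3×3 matrices over k. (Correspondingly, 𝓡_X has exactly 5 isomorphism classes of simple modules, of dimensions 1, 1, 1, 2 and 3.) -/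
/-- Relations on a two-element set, as Boolean `2 × 2` matrices listed row by row. -/
abbrev BoolQuad := Bool × Bool × Bool × Bool

namespace BoolQuad

/-- The Boolean matrix product. -/
def comp : BoolQuad → BoolQuad → BoolQuad
  | (a, b, c, d), (a', b', c', d') =>
    (a && a' || b && c', a && b' || b && d', c && a' || d && c', c && b' || d && d')

/-- The coordinates of a subset of a two-element set in the free module on its nonempty
subsets; the empty subset is sent to `0`. -/
def subsetVec (x y : Bool) : Fin 3 → ℤ :=
  ![(x && !y).toInt, (!x && y).toInt, (x && y).toInt]

/-- The sign of a permutation matrix, extended by zero. -/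
def signRep : BoolQuad → ℤ
  | (true, false, false, true) => 1
  | (false, true, true, false) => -1
  | _ => 0

/-- The action on the two linear orders of a two-element set, where relations that are neither
permutations nor permuted linear orders act by zero. -/
def orderRep : BoolQuad → Matrix (Fin 2) (Fin 2) ℤ
  | (true, false, false, true) => !![1, 0; 0, 1]
  | (false, true, true, false) => !![0, 1; 1, 0]
  | (true, true, false, true) => !![1, 0; 0, 0]
  | (true, true, true, false) => !![0, 1; 0, 0]
  | (false, true, true, true) => !![0, 0; 1, 0]
  | (true, false, true, true) => !![0, 0; 0, 1]
  | _ => 0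

/-- The action by direct image on the free module on the nonempty subsets. -/
def imageRep : BoolQuad → Matrix (Fin 3) (Fin 3) ℤ
  | (a, b, c, d) => .of fun i j =>
    ![subsetVec a c i, subsetVec b d i, subsetVec (a || b) (c || d) i] j

/-- The product of the five integral representations. -/
def rep (q : BoolQuad) : ℤ × ℤ × ℤ × Matrix (Fin 2) (Fin 2) ℤ × Matrix (Fin 3) (Fin 3) ℤ :=
  (1, signRep q ^ 2, signRep q, orderRep q, imageRep q)

theorem signRep_comp (p q : BoolQuad) : signRep (comp p q) = signRep p * signRep q := by
  revert p q
  decide +kernel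

theorem orderRep_comp (p q : BoolQuad) : orderRep (comp p q) = orderRep p * orderRep q := by
  revert p q
  decide +kernel

theorem imageRep_comp (p q : BoolQuad) : imageRep (comp p q) = imageRep p * imageRep q := by
  revert p q
  decide +kernel

theorem rep_comp (p q : BoolQuad) : rep (comp p q) = rep p * rep q := by
  simp [rep, signRep_comp, orderRep_comp, imageRep_comp, mul_pow]

theorem rep_diag : rep (true, false, false, true) = 1 := by
  decide +kernel

end BoolQuad

/-- The Boolean matrix of a relation on a set enumerated by `Fin 2`. -/
noncomputable def boolQuadEquiv {X : Type*} (e : X ≃ Fin 2) : Set (X × X) ≃ BoolQuad := by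
  classical exact
  { toFun R := (decide ((e.symm 0, e.symm 0) ∈ R), decide ((e.symm 0, e.symm 1) ∈ R),
      decide ((e.symm 1, e.symm 0) ∈ R), decide ((e.symm 1, e.symm 1) ∈ R))
    invFun q := {p | !![q.1, q.2.1; q.2.2.1, q.2.2.2] (e p.1) (e p.2) = true}
    left_inv R := by
      ext ⟨x, y⟩
      obtain ⟨i, rfl⟩ := e.symm.surjective x
      obtain ⟨j, rfl⟩ := e.symm.surjective y
      fin_cases i <;> fin_cases j <;> simp
    right_inv q := by simp }

theorem boolQuadEquiv_mul {X : Type*} (e : X ≃ Fin 2) (R S : Set (X × X)) :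
    boolQuadEquiv e (R * S) = (boolQuadEquiv e R).comp (boolQuadEquiv e S) := by
  have mem_mul (x y : X) : (x, y) ∈ R * S ↔
      (x, e.symm 0) ∈ R ∧ (e.symm 0, y) ∈ S ∨ (x, e.symm 1) ∈ R ∧ (e.symm 1, y) ∈ S := by
    change (∃ z, (x, z) ∈ R ∧ (z, y) ∈ S) ↔ _
    rw [← e.symm.exists_congr_right, Fin.exists_fin_two]
  refine Prod.ext ?_ (Prod.ext ?_ (Prod.ext ?_ ?_)) <;>
    (rw [Bool.eq_iff_iff]; simp [boolQuadEquiv, BoolQuad.comp, mem_mul])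

theorem boolQuadEquiv_one {X : Type*} (e : X ≃ Fin 2) :
    boolQuadEquiv e 1 = (true, false, false, true) := by
  have mem_one (x y : X) : (x, y) ∈ (1 : Set (X × X)) ↔ x = y := Iff.rfl
  simp [boolQuadEquiv, mem_one]

/-- Extension of scalars from `ℤ` on the product of the five matrix rings. -/
def matrixProdCast (k : Type*) [CommRing k] :
    ℤ × ℤ × ℤ × Matrix (Fin 2) (Fin 2) ℤ × Matrix (Fin 3) (Fin 3) ℤ →+*
      k × k × k × Matrix (Fin 2) (Fin 2) k × Matrix (Fin 3) (Fin 3) k :=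
  let ι := Int.castRingHom k
  ι.prodMap (ι.prodMap (ι.prodMap (ι.mapMatrix.prodMap ι.mapMatrix)))

theorem BoolQuad.linearIndependent_rep {k : Type*} [Field k] (hk : (2 : k) ≠ 0) :
    LinearIndependent k fun q => matrixProdCast k (rep q) := by
  rw [Fintype.linearIndependent_iff]
  intro c hc
  simp [Fintype.sum_prod_type, matrixProdCast, rep, Prod.ext_iff,
    ← Matrix.ext_iff, Fin.forall_fin_succ, signRep, orderRep, imageRep,
    subsetVec] at hc
  have swap : c (false, true, true, false) = 0 := by
    have : 2 * c (false, true, true, false) = 0 := by grind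
    simpa [hk] using this
  simp only [Prod.forall, Bool.forall_bool]
  grind

/-- The product of the five representations of the monoid of relations, over `k`. -/
noncomputable def relRep (k : Type*) [CommRing k] {X : Type*} (e : X ≃ Fin 2) :
    Set (X × X) →* k × k × k × Matrix (Fin 2) (Fin 2) k × Matrix (Fin 3) (Fin 3) k :=
  (matrixProdCast k).toMonoidHom.comp
    { toFun R := (boolQuadEquiv e R).rep
      map_one' := by rw [boolQuadEquiv_one, BoolQuad.rep_diag]
      map_mul' R S := by rw [boolQuadEquiv_mul, BoolQuad.rep_comp] }

theorem lift_relRep_injective {k : Type*} [Field k] (hk : (2 : k) ≠ 0) {X : Type*}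
    (e : X ≃ Fin 2) : Function.Injective (MonoidAlgebra.lift k _ (Set (X × X)) (relRep k e)) := by
  have indep := (BoolQuad.linearIndependent_rep hk).comp _ (boolQuadEquiv e).injective
  intro f g h
  rw [MonoidAlgebra.lift_apply, MonoidAlgebra.lift_apply] at h
  exact MonoidAlgebra.coeff_injective (indep h)

/-- For a two-element set `X` and an algebraically closed field `k` of characteristic
different from 2, the algebra of relations `𝓡_X = k𝓒(X,X)` is isomorphic, as a
`k`-algebra, to `k × k × k × M₂(k) × M₃(k)`. -/
theorem relAlgebra_card_two_wedderburn (k : Type) [Field k] [IsAlgClosed k]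
    (hk : ringChar k ≠ 2) (X : Type) [Fintype X] (hX : Fintype.card X = 2) :
    Nonempty (MonoidAlgebra k (Set (X × X)) ≃ₐ[k]
      (k × k × k × Matrix (Fin 2) (Fin 2) k × Matrix (Fin 3) (Fin 3) k)) := by
  classical
  let φ := MonoidAlgebra.lift k _ (Set (X × X)) (relRep k (Fintype.equivFinOfCardEq hX))
  have inj : Function.Injective φ := lift_relRep_injective (Ring.two_ne_zero hk) _
  let b := MonoidAlgebra.basis (Set (X × X)) k
  have : Module.Finite k (MonoidAlgebra k (Set (X × X))) := .of_basis b
  have dim : Module.finrank k (MonoidAlgebra k (Set (X × X))) = Module.finrank k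
      (k × k × k × Matrix (Fin 2) (Fin 2) k × Matrix (Fin 3) (Fin 3) k) := by
    simp [Module.finrank_eq_card_basis b, Module.finrank_matrix, hX]
  exact ⟨.ofBijective φ ⟨inj,
    (LinearMap.injective_iff_surjective_of_finrank_eq_finrank (f := φ.toLinearMap) dim).1 inj⟩⟩
end

section
/- Let k be a field of characteristic zero and X a set with three elements. Then the Jacobson radical J(𝓡_X) of the 512-dimensional monoid algebra 𝓡_X = k𝓒(X,X) of the monoid of relations on X has dimension 42 as a k-vector space. -/
section Trace

variable (k : Type*) {A : Type*} [Field k] [Ring A] [Algebra k A] [FiniteDimensional k A]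

include k in
theorem isNilpotent_of_mem_jacobson_bot {a : A} (ha : a ∈ Ideal.jacobson (⊥ : Ideal A)) :
    IsNilpotent a := by
  have : IsArtinianRing A := IsArtinianRing.of_finite k A
  obtain ⟨n, hn⟩ := IsArtinianRing.isNilpotent_jacobson_bot (R := A)
  exact ⟨n, by simpa [hn] using Ideal.pow_mem_pow ha n⟩

theorem trace_eq_zero_of_mem_jacobson_bot {n : Type*} [Fintype n] [DecidableEq n]
    (ρ : A →ₐ[k] Matrix n n k) {a : A} (ha : a ∈ Ideal.jacobson (⊥ : Ideal A)) :
    (ρ a).trace = 0 :=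
  (Matrix.isNilpotent_trace_of_isNilpotent
    ((isNilpotent_of_mem_jacobson_bot k ha).map ρ)).eq_zero

omit [Field k] [Algebra k A] [FiniteDimensional k A] in
theorem mul_mem_jacobson_bot {a : A} (ha : a ∈ Ideal.jacobson (⊥ : Ideal A)) (b : A) :
    a * b ∈ Ideal.jacobson (⊥ : Ideal A) := by
  rw [Ideal.jacobson_bot] at *
  exact Ideal.mul_mem_right _ _ ha

end Trace

section Regular

variable (k G : Type*) [Field k] [Monoid G] [Fintype G] [DecidableEq G]

/-- The left regular representation of a finite monoid by matrices. -/
def regMatrix : G →* Matrix G G k where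
  toFun g := Matrix.of fun x y => if x = g * y then 1 else 0
  map_one' := by ext x y; simp [Matrix.one_apply]
  map_mul' g h := by ext x y; simp [Matrix.mul_apply, mul_assoc]

theorem trace_regMatrix (g : G) :
    (regMatrix k G g).trace = ((Finset.univ.filter fun x => x = g * x).card : k) := by
  simp [Matrix.trace, regMatrix]

end Regular

section Orders

variable {X : Type*}

/-- A relation is an order if it is reflexive, antisymmetric and transitive. -/
structure IsOrderRel_s9 (T : Set (X × X)) : Prop where
  refl : ∀ x, (x, x) ∈ T
  antisymm : ∀ x y, (x, y) ∈ T → (y, x) ∈ T → x = y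
  trans : ∀ x y z, (x, y) ∈ T → (y, z) ∈ T → (x, z) ∈ T

/-- `α⁻¹Rβ` lies between the diagonal and `T`. -/
def Between (T R : Set (X × X)) (α β : Equiv.Perm X) : Prop :=
  (∀ x, (α x, β x) ∈ R) ∧ ∀ z x, (α z, β x) ∈ R → (z, x) ∈ T

theorem IsOrderRel_s9.perm_eq_one [Finite X] {T : Set (X × X)} (hT : IsOrderRel_s9 T)
    {κ : Equiv.Perm X} (h : ∀ x, (x, κ x) ∈ T) : κ = 1 := by
  have hpow : ∀ (n : ℕ) x, (x, (κ ^ n) x) ∈ T := by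
    intro n
    induction n with
    | zero => exact fun x => hT.refl x
    | succ n ih => exact fun x => hT.trans _ _ _ (h x) (by simpa [pow_succ] using ih (κ x))
  ext x
  refine (hT.antisymm _ _ (h x) ?_).symm
  have := hpow (orderOf κ - 1) (κ x)
  rwa [← Equiv.Perm.mul_apply, ← pow_succ, Nat.sub_add_cancel (orderOf_pos κ),
    pow_orderOf_eq_one] at this

theorem Between.mul {T R S : Set (X × X)} (hT : IsOrderRel_s9 T) {α β γ : Equiv.Perm X}
    (hR : Between T R α β) (hS : Between T S β γ) : Between T (R * S) α γ := by
  refine ⟨fun x => ⟨β x, hR.1 x, hS.1 x⟩, ?_⟩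
  rintro z x ⟨y, h1, h2⟩
  obtain ⟨w, rfl⟩ := β.surjective y
  exact hT.trans _ _ _ (hR.2 _ _ h1) (hS.2 _ _ h2)

theorem Between.exists_of_mul [Finite X] {T R S : Set (X × X)} (hT : IsOrderRel_s9 T)
    {α γ : Equiv.Perm X} (h : Between T (R * S) α γ) :
    ∃ β, Between T R α β ∧ Between T S β γ := by
  choose y hy using h.1
  have hinj : Function.Injective y := fun x x' hxx => hT.antisymm _ _
    (h.2 _ _ ⟨y x, (hy x).1, by simpa [hxx] using (hy x').2⟩)
    (h.2 _ _ ⟨y x, by simpa [hxx] using (hy x').1, (hy x).2⟩)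
  refine ⟨Equiv.ofBijective y (Finite.injective_iff_bijective.1 hinj), ⟨fun x => (hy x).1, ?_⟩,
    ⟨fun x => (hy x).2, ?_⟩⟩
  · exact fun z x hz => h.2 _ _ ⟨_, hz, (hy x).2⟩
  · exact fun z x hz => h.2 _ _ ⟨_, (hy z).1, hz⟩

theorem Between.unique [Finite X] {T R : Set (X × X)} (hT : IsOrderRel_s9 T)
    {α β β' : Equiv.Perm X} (h : Between T R α β) (h' : Between T R α β') : β = β' := by
  have : β⁻¹ * β' = 1 := hT.perm_eq_one fun x => h.2 _ _ (by simpa using h'.1 x)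
  exact inv_mul_eq_one.1 this

theorem between_one_iff {T : Set (X × X)} (hT : IsOrderRel_s9 T) {α β : Equiv.Perm X} :
    Between T 1 α β ↔ α = β := by
  refine ⟨fun h => Equiv.ext h.1, ?_⟩
  rintro rfl
  refine ⟨fun x => rfl, fun z x h => ?_⟩
  rw [α.injective h]
  exact hT.refl x

variable [Fintype X] [DecidableEq X] (k : Type*) [Field k]

open Classical in
/-- The matrix representation of the monoid of relations attached to an order. -/
noncomputable def orderMatrix {T : Set (X × X)} (hT : IsOrderRel_s9 T) :
    Set (X × X) →* Matrix (Equiv.Perm X) (Equiv.Perm X) k where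
  toFun R := Matrix.of fun α β => if Between T R α β then 1 else 0
  map_one' := by ext α β; simp [Matrix.one_apply, between_one_iff hT]
  map_mul' R S := by
    ext α γ
    simp only [Matrix.mul_apply, Matrix.of_apply, ← ite_and, mul_ite, mul_one, mul_zero]
    by_cases h : Between T (R * S) α γ
    · obtain ⟨β, h1, h2⟩ := h.exists_of_mul hT
      rw [if_pos h, Finset.sum_eq_single β, if_pos ⟨h2, h1⟩]
      · exact fun β' _ hne => if_neg fun h' => hne (h'.2.unique hT h1)
      · simp
    · rw [if_neg h, Finset.sum_eq_zero]
      exact fun β _ => if_neg fun h' => h (h'.2.mul hT h'.1)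

/-- The extension of `orderMatrix` to the algebra of relations. -/
noncomputable def orderRep {T : Set (X × X)} (hT : IsOrderRel_s9 T) :
    MonoidAlgebra k (Set (X × X)) →ₐ[k] Matrix (Equiv.Perm X) (Equiv.Perm X) k :=
  MonoidAlgebra.lift k _ _ (orderMatrix k hT)

open Classical in
theorem orderRep_of {T : Set (X × X)} (hT : IsOrderRel_s9 T) (R : Set (X × X))
    (α β : Equiv.Perm X) :
    orderRep k hT (MonoidAlgebra.of k _ R) α β = if Between T R α β then 1 else 0 := by
  simp [orderRep, orderMatrix]

theorem orderRep_apply_mul {T : Set (X × X)} (hT : IsOrderRel_s9 T) {π : Equiv.Perm X}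
    (hπ : ∀ z x, (π z, π x) ∈ T ↔ (z, x) ∈ T) (a : MonoidAlgebra k (Set (X × X)))
    (α β : Equiv.Perm X) : orderRep k hT a (α * π) (β * π) = orderRep k hT a α β := by
  classical
  induction a using MonoidAlgebra.induction_on with
  | of R =>
    rw [orderRep_of, orderRep_of]
    have : Between T R (α * π) (β * π) ↔ Between T R α β := by
      refine and_congr ⟨fun h x => by simpa using h (π⁻¹ x), fun h x => h (π x)⟩
        ⟨fun h z x hz => ?_, fun h z x hz => (hπ _ _).1 (h _ _ hz)⟩
      have := h (π⁻¹ z) (π⁻¹ x) (by simpa using hz)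
      simpa using (hπ _ _).2 this
    exact if_congr this rfl rfl
  | add a b ha hb => simp [ha, hb]
  | smul r a ha => simp [ha]

/-- The relation `βTα⁻¹`. -/
def conjTranslate (T : Set (X × X)) (β α : Equiv.Perm X) : Set (X × X) :=
  {p | (β⁻¹ p.1, α⁻¹ p.2) ∈ T}

omit [DecidableEq X] in
theorem Between.exists_of_conjTranslate {T : Set (X × X)} (hT : IsOrderRel_s9 T)
    {α β γ δ : Equiv.Perm X} (h : Between T (conjTranslate T β α) γ δ) :
    ∃ π : Equiv.Perm X, (∀ z x, (π z, π x) ∈ T ↔ (z, x) ∈ T) ∧ γ = β * π ∧ δ = α * π := by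
  have h1 : (α⁻¹ * δ) * (β⁻¹ * γ)⁻¹ = 1 := hT.perm_eq_one fun x => by
    simpa [conjTranslate] using h.1 (γ⁻¹ (β x))
  have h2 : α⁻¹ * δ = β⁻¹ * γ := mul_inv_eq_one.1 h1
  have h3 : ∀ z x, ((β⁻¹ * γ) z, (β⁻¹ * γ) x) ∈ T → (z, x) ∈ T := fun z x hz =>
    h.2 z x (by
      change ((β⁻¹ * γ) z, (α⁻¹ * δ) x) ∈ T
      rwa [h2])
  refine ⟨β⁻¹ * γ, fun z x => ⟨h3 z x, fun hz => ?_⟩, by group, by rw [← h2]; group⟩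
  generalize β⁻¹ * γ = π at h3
  have hpow : ∀ (n : ℕ) z x, ((π ^ n) z, (π ^ n) x) ∈ T → (z, x) ∈ T := by
    intro n
    induction n with
    | zero => exact fun z x h => h
    | succ n ih => exact fun z x h => h3 _ _ (ih _ _ (by simpa [pow_succ] using h))
  refine hpow (orderOf π - 1) _ _ ?_
  rwa [← Equiv.Perm.mul_apply, ← Equiv.Perm.mul_apply, ← pow_succ,
    Nat.sub_add_cancel (orderOf_pos π), pow_orderOf_eq_one]

theorem orderRep_eq_zero_of_mem_jacobson_bot [CharZero k] {T : Set (X × X)}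
    (hT : IsOrderRel_s9 T) {a : MonoidAlgebra k (Set (X × X))}
    (ha : a ∈ Ideal.jacobson (⊥ : Ideal (MonoidAlgebra k (Set (X × X))))) :
    orderRep k hT a = 0 := by
  classical
  ext α β
  have key := trace_eq_zero_of_mem_jacobson_bot k (orderRep k hT)
    (mul_mem_jacobson_bot ha (MonoidAlgebra.of k _ (conjTranslate T β α)))
  have hterm : ∀ δ γ, orderRep k hT a δ γ *
      orderRep k hT (MonoidAlgebra.of k _ (conjTranslate T β α)) γ δ =
      (if Between T (conjTranslate T β α) γ δ then 1 else 0) * orderRep k hT a α β := by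
    intro δ γ
    rw [orderRep_of]
    split_ifs with h
    · obtain ⟨π, hπ, rfl, rfl⟩ := h.exists_of_conjTranslate hT
      rw [orderRep_apply_mul k hT hπ]; ring
    · simp
  have hself : Between T (conjTranslate T β α) β α :=
    ⟨fun x => by simpa [conjTranslate] using hT.refl x,
      fun z x h => by simpa [conjTranslate] using h⟩
  simp only [map_mul, Matrix.trace, Matrix.diag_apply, Matrix.mul_apply, hterm,
    ← Finset.sum_mul, Finset.sum_boole] at key
  refine (mul_eq_zero.1 key).resolve_left ?_
  rw [← Nat.cast_sum, Nat.cast_eq_zero, Finset.sum_eq_zero_iff]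
  exact fun h => Finset.card_ne_zero_of_mem (a := β) (by simpa using hself)
    (h α (Finset.mem_univ α))

end Orders

section Codes

/-- The relation on `Fin 3` whose nine matrix entries are the binary digits of `n`. -/
def ofCode (n : ℕ) : Set (Fin 3 × Fin 3) := {p | n.testBit (3 * p.1 + p.2)}

/-- Composition of relations on codes. -/
def mulCode (a b : ℕ) : ℕ :=
  ((a &&& 73) * (b &&& 7)) ||| (((a >>> 1) &&& 73) * ((b >>> 3) &&& 7)) |||
    (((a >>> 2) &&& 73) * ((b >>> 6) &&& 7))

theorem testBit_mul_masks : ∀ u ≤ 73, u &&& 73 = u → ∀ v ≤ 7, ∀ i j : Fin 3,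
    (u * v).testBit (3 * i + j) = (u.testBit (3 * i) && v.testBit j) := by
  decide +kernel

theorem testBit_73 : ∀ i : Fin 3, (73).testBit (3 * (i : ℕ)) = true := by decide

theorem testBit_7 : ∀ i : Fin 3, (7).testBit (i : ℕ) = true := by decide

theorem testBit_and_mul_and (c r : ℕ) (i j : Fin 3) :
    ((c &&& 73) * (r &&& 7)).testBit (3 * i + j) = (c.testBit (3 * i) && r.testBit j) := by
  rw [testBit_mul_masks _ Nat.and_le_right (by rw [Nat.and_assoc, Nat.and_self]) _
    Nat.and_le_right, Nat.testBit_and, Nat.testBit_and, testBit_73, testBit_7]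
  simp

theorem ofCode_mulCode (a b : ℕ) : ofCode (mulCode a b) = ofCode a * ofCode b := by
  ext ⟨z, x⟩
  change (mulCode a b).testBit (3 * z + x) = true ↔
    ∃ y : Fin 3, a.testBit (3 * z + y) = true ∧ b.testBit (3 * y + x) = true
  simp only [mulCode, Nat.testBit_or, testBit_and_mul_and, Nat.testBit_shiftRight,
    Fin.exists_fin_succ]
  simp [add_comm, or_assoc]

theorem ofCode_injOn {a b : ℕ} (ha : a < 512) (hb : b < 512) (h : ofCode a = ofCode b) :
    a = b := by
  refine Nat.eq_of_testBit_eq fun i => ?_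
  by_cases hi : i < 9
  · have := Set.ext_iff.1 h (⟨i / 3, by omega⟩, ⟨i % 3, by omega⟩)
    simp only [ofCode, Set.mem_ofPred_eq, Nat.div_add_mod] at this
    exact Bool.eq_iff_iff.2 this
  · have h512 : 512 ≤ 2 ^ i := by
      calc 512 = 2 ^ 9 := by norm_num
        _ ≤ 2 ^ i := Nat.pow_le_pow_right (by norm_num) (by omega)
    rw [Nat.testBit_lt_two_pow (ha.trans_le h512), Nat.testBit_lt_two_pow (hb.trans_le h512)]

theorem exists_ofCode_eq (R : Set (Fin 3 × Fin 3)) : ∃ n < 512, ofCode n = R := by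
  classical
  have : Function.Bijective fun n : Fin 512 => ofCode n :=
    (Fintype.bijective_iff_injective_and_card _).2
      ⟨fun a b h => Fin.ext (ofCode_injOn a.2 b.2 h), by simp⟩
  obtain ⟨n, hn⟩ := this.2 R
  exact ⟨n, n.2, hn⟩

theorem ofCode_273 : ofCode 273 = 1 := by
  have : ∀ p : Fin 3 × Fin 3, (273).testBit (3 * p.1 + p.2 : ℕ) = true ↔ p.1 = p.2 := by decide
  exact Set.ext this

/-- The codes of the 19 order relations on `Fin 3`, sorted by size. -/
def orderCodes : List ℕ :=
  [273, 275, 277, 281, 305, 337, 401, 279, 309, 313, 345, 403, 465, 311, 317, 377, 407, 467, 473]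

/-- The codes of the graphs of the permutations of `Fin 3`. -/
def permCodes : List ℕ := [273, 161, 266, 98, 140, 84]

/-- The codes of the relations that factor through no two-element set and are not of the form
order times permutation, each paired with the code of its closure if that has the form order times
permutation, and with `0` otherwise. -/
def badCodes : List (ℕ × ℕ) :=
  [(94, 95), (110, 111), (115, 123), (117, 125), (157, 159), (171, 187), (174, 190), (181, 183),
   (206, 207), (213, 215), (229, 485), (230, 486), (234, 250), (236, 492), (238, 0), (241, 249),
   (244, 500), (245, 0), (285, 317), (286, 318), (299, 303), (307, 311), (334, 335), (339, 467),
   (342, 470), (346, 474), (348, 380), (350, 0), (355, 359), (369, 377), (370, 498), (371, 0),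
   (395, 459), (397, 461), (405, 407), (409, 473), (412, 444), (413, 0), (419, 423), (425, 489),
   (426, 442), (427, 0)]

/-- The set of codes of relations that factor through a two-element set. -/
def lowCodes : ℕ :=
  13403701488169590718728287531101094857162888859306842962414433129198433734560829488754341541279189115983561661966158845292513940643150238306312843119558655

/-- The codes with coefficient `1` in the identity of the ideal spanned by `lowCodes`. -/
def idemPos : List ℕ :=
  [38, 44, 53, 63, 104, 121, 134, 151, 194, 200, 209, 219, 278, 283, 295, 297, 316, 341, 344,
   351, 365, 375, 379, 387, 415, 433, 438, 443, 445, 455, 457, 466, 477, 499, 501, 504, 511]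

/-- The codes with coefficient `-1` in the identity of the ideal spanned by `lowCodes`. -/
def idemNeg : List ℕ :=
  [39, 45, 54, 60, 105, 120, 135, 150, 195, 201, 210, 216, 287, 294, 300, 315, 343, 347, 349,
   360, 373, 383, 390, 411, 435, 437, 441, 447, 450, 456, 469, 479, 497, 503, 507, 509]

/-- The codes of relations with all columns but the first two empty. -/
def colCodes : List ℕ :=
  [0, 1, 2, 3, 8, 9, 10, 11, 16, 17, 18, 19, 24, 25, 26, 27, 64, 65, 66, 67, 72, 73, 74, 75, 80,
   81, 82, 83, 88, 89, 90, 91, 128, 129, 130, 131, 136, 137, 138, 139, 144, 145, 146, 147, 152,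
   153, 154, 155, 192, 193, 194, 195, 200, 201, 202, 203, 208, 209, 210, 211, 216, 217, 218, 219]

/-- The codes of relations with all rows but the first two empty. -/
def rowCodes : List ℕ :=
  [0, 1, 2, 3, 4, 5, 6, 7, 8, 9, 10, 11, 12, 13, 14, 15, 16, 17, 18, 19, 20, 21, 22, 23, 24, 25,
   26, 27, 28, 29, 30, 31, 32, 33, 34, 35, 36, 37, 38, 39, 40, 41, 42, 43, 44, 45, 46, 47, 48,
   49, 50, 51, 52, 53, 54, 55, 56, 57, 58, 59, 60, 61, 62, 63]

theorem mulCode_mem_colCodes : ∀ n < 512, mulCode n 17 ∈ colCodes := by decide +kernel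

theorem mulCode_mem_rowCodes : ∀ n < 512, mulCode 17 n ∈ rowCodes := by decide +kernel

theorem colCodes_mul : ∀ u ∈ colCodes, mulCode u 17 = u := by decide +kernel

theorem lowCodes_eq_foldl : lowCodes =
    (colCodes.flatMap fun u => rowCodes.map (mulCode u)).foldl (fun s n => s ||| 1 <<< n) 0 := by
  decide +kernel

theorem idem_mul_col : ∀ u ∈ colCodes, (idemPos.map (mulCode · u)).isPerm
    (u :: idemNeg.map (mulCode · u)) = true := by
  decide +kernel

theorem row_mul_idem : ∀ v ∈ rowCodes, (idemPos.map (mulCode v)).isPerm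
    (v :: idemNeg.map (mulCode v)) = true := by
  decide +kernel

theorem idem_low : ∀ n ∈ idemPos ++ idemNeg, lowCodes.testBit n = true := by decide +kernel

theorem low_or_bad_or_order : ∀ n < 512, lowCodes.testBit n = true ∨ n ∈ badCodes.map Prod.fst ∨
    n ∈ orderCodes.flatMap fun t => permCodes.map (mulCode t) := by
  decide +kernel

theorem bad_not_low : ∀ p ∈ badCodes, lowCodes.testBit p.1 = false ∧ p.1 < 512 ∧ p.2 < 512 := by
  decide +kernel

theorem bad_nodup : (badCodes.map Prod.fst).Nodup := by decide +kernel

theorem bad_disjoint : ∀ p ∈ badCodes, p.2 ∉ badCodes.map Prod.fst := by decide +kernel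

theorem bad_mul_bad : ∀ p ∈ badCodes, ∀ q ∈ badCodes,
    ([mulCode p.1 q.1, mulCode p.2 q.2].filter (!lowCodes.testBit ·)).isPerm
      ([mulCode p.1 q.2, mulCode p.2 q.1].filter (!lowCodes.testBit ·)) = true := by
  decide +kernel

/-- The relation with code `r` lies between the diagonal and the relation with code `t`. -/
def betweenCode (t r : ℕ) : Bool := (r &&& 273 == 273) && (r &&& t == r)

theorem betweenCode_bad : ∀ p ∈ badCodes, ∀ s ∈ permCodes, ∀ s' ∈ permCodes, ∀ t ∈ orderCodes,
    betweenCode t (mulCode (mulCode s p.1) s') = betweenCode t (mulCode (mulCode s p.2) s') := by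
  decide +kernel

theorem betweenCode_order : ∀ i j : Fin orderCodes.length, ∀ s ∈ permCodes,
    betweenCode (orderCodes.get i) (mulCode (orderCodes.get j) s) = true → s = 273 ∧ j ≤ i := by
  decide +kernel

theorem betweenCode_self : ∀ i ∈ orderCodes, betweenCode i i = true := by
  decide +kernel

end Codes

section Corner

/-- The codes of relations supported on the first two rows and columns. -/
def cornerCodes : List ℕ :=
  [0, 1, 2, 3, 8, 9, 10, 11, 16, 17, 18, 19, 24, 25, 26, 27]

/-- The number of relations fixed by left composition with a relation, by code; correct for the
codes in `cornerCodes`. -/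
def cornerTrace : List ℕ :=
  [1, 8, 1, 8, 0, 0, 0, 0, 1, 8, 8, 8, 0, 0,
    0, 0, 8, 64, 8, 27, 0, 0, 0, 0, 8, 27, 8, 8]

/-- The matrix `252 • G⁻¹`, where `G` is the trace form of the left regular representation on the
relations in `cornerCodes`. -/
def cornerInv : List (List ℤ) :=
  [[288, 0, 0, 0, 0, 0, 0, 0, 0, 0, 0, 0, 0, 0, 0, -36],
    [0, 0, 0, 0, 0, 0, 0, 0, 57, 0, -57, 0, -57, 0, 21, 36],
    [0, 0, 57, -57, 0, 0, 0, 0, 0, 0, -57, 21, 0, 0, 0, 36],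
    [0, 0, -57, 57, 0, 0, 0, 0, -57, 0, 78, -21, 57, 0, -21, -36],
    [0, 0, 0, 0, 57, -57, 0, 0, 0, 0, 0, 0, -57, 21, 0, 36],
    [0, 0, 0, 0, -57, 57, 0, 0, -57, 0, 57, 0, 78, -21, -21, -36],
    [0, 0, 0, 0, 0, 0, 14, -14, 0, 0, 0, 0, 0, 0, -14, 14],
    [0, 0, 0, 0, 0, 0, -14, 14, 21, 0, -21, 0, -21, 0, 35, -14],
    [0, 57, 0, -57, 0, -57, 0, 21, 0, 0, 0, 0, 0, 0, 0, 36],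
    [0, 0, 0, 0, 0, 0, 0, 0, 0, 14, 0, -14, 0, -14, 0, 14],
    [0, -57, -57, 78, 0, 57, 0, -21, 0, 0, 57, -21, 0, 0, 0, -36],
    [0, 0, 21, -21, 0, 0, 0, 0, 0, -14, -21, 35, 0, 14, 0, -14],
    [0, -57, 0, 57, -57, 78, 0, -21, 0, 0, 0, 0, 57, -21, 0, -36],
    [0, 0, 0, 0, 21, -21, 0, 0, 0, -14, 0, 14, -21, 35, 0, -14],
    [0, 21, 0, -21, 0, -21, -14, 35, 0, 0, 0, 0, 0, 0, 14, -14],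
    [-36, 36, 36, -36, 36, -36, 14, -14, 36, 14, -36, -14, -36, -14, -14, 64]]

theorem mulCode_mem_cornerCodes : ∀ u ∈ colCodes, mulCode 17 u ∈ cornerCodes := by
  decide +kernel

theorem card_fixed_corner : ∀ w ∈ cornerCodes,
    ((Finset.range 512).filter fun m => mulCode w m = m).card = cornerTrace.getD w 0 := by
  decide +kernel

theorem mulCode_corner : ∀ v ∈ cornerCodes, ∀ w ∈ cornerCodes, mulCode v w ∈ cornerCodes := by
  decide +kernel

theorem cornerTrace_mul_cornerInv : ∀ i j : Fin cornerCodes.length,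
    ∑ l : Fin cornerCodes.length,
      (cornerTrace.getD (mulCode (cornerCodes.get i) (cornerCodes.get l)) 0 : ℤ) *
        (cornerInv.getD l []).getD j 0 = if i = j then 252 else 0 := by
  decide +kernel

end Corner

section Permutations

/-- The code of the graph of a permutation. -/
def permCode (σ : Equiv.Perm (Fin 3)) : ℕ :=
  2 ^ (3 * (σ 0 : ℕ)) + 2 ^ (3 * (σ 1 : ℕ) + 1) + 2 ^ (3 * (σ 2 : ℕ) + 2)

theorem permCode_mem : ∀ σ, permCode σ ∈ permCodes := by decide +kernel

theorem exists_permCode_eq : ∀ s ∈ permCodes, ∃ σ, permCode σ = s := by decide +kernel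

theorem permCode_eq_273 : ∀ σ, permCode σ = 273 → σ = 1 := by decide +kernel

theorem permCode_one : permCode 1 = 273 := by decide +kernel

theorem mulCode_permCode : ∀ σ τ, mulCode (permCode σ) (permCode τ) = permCode (σ * τ) := by
  decide +kernel

theorem testBit_permCode : ∀ σ, ∀ z x : Fin 3,
    (permCode σ).testBit (3 * z + x) = true ↔ z = σ x := by
  decide +kernel

theorem mem_ofCode_permCode {σ : Equiv.Perm (Fin 3)} {z x : Fin 3} :
    (z, x) ∈ ofCode (permCode σ) ↔ z = σ x :=
  testBit_permCode σ z x

theorem mulCode_lt (a b : ℕ) : mulCode a b < 512 := by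
  have h : ∀ c r : ℕ, (c &&& 73) * (r &&& 7) < 2 ^ 9 := fun c r =>
    (Nat.mul_le_mul Nat.and_le_right Nat.and_le_right).trans_lt (by norm_num)
  exact Nat.or_lt_two_pow (Nat.or_lt_two_pow (h _ _) (h _ _)) (h _ _)

theorem ofCode_and (a b : ℕ) : ofCode (a &&& b) = ofCode a ∩ ofCode b := by
  ext p
  simp [ofCode]

theorem ofCode_subset_iff {a b : ℕ} (ha : a < 512) :
    ofCode a ⊆ ofCode b ↔ a &&& b = a := by
  rw [← Set.inter_eq_left, ← ofCode_and]
  exact ⟨ofCode_injOn (Nat.and_le_left.trans_lt ha) ha, fun h => by rw [h]⟩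

theorem between_ofCode {t a : ℕ} {α β : Equiv.Perm (Fin 3)} :
    Between (ofCode t) (ofCode a) α β ↔
      betweenCode t (mulCode (mulCode (permCode α⁻¹) a) (permCode β)) = true := by
  have hmem : ∀ z x, (z, x) ∈ ofCode (mulCode (mulCode (permCode α⁻¹) a) (permCode β)) ↔
      (α z, β x) ∈ ofCode a := by
    intro z x
    rw [ofCode_mulCode, ofCode_mulCode]
    constructor
    · rintro ⟨y, ⟨w, h1, h2⟩, h3⟩
      obtain rfl := mem_ofCode_permCode.1 h1
      obtain rfl := mem_ofCode_permCode.1 h3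
      simpa using h2
    · exact fun h => ⟨β x, ⟨α z, mem_ofCode_permCode.2 (by simp), h⟩, mem_ofCode_permCode.2 rfl⟩
  simp only [betweenCode, Bool.and_eq_true, beq_iff_eq, ← ofCode_subset_iff (mulCode_lt _ _)]
  rw [Nat.and_comm, ← ofCode_subset_iff (by norm_num), ofCode_273]
  refine and_congr ⟨?_, fun h x => (hmem x x).1 (h rfl)⟩
    ⟨fun h p hp => h _ _ ((hmem _ _).1 hp), fun h z x hz => h ((hmem z x).2 hz)⟩
  rintro h ⟨z, x⟩ (rfl : z = x)
  exact (hmem _ _).2 (h _)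

theorem isOrderRel_ofCode {t : ℕ} (ht : t ∈ orderCodes) : IsOrderRel_s9 (ofCode t) := by
  have h : ∀ t ∈ orderCodes, (∀ x : Fin 3, t.testBit (3 * x + x) = true) ∧
      (∀ x y : Fin 3, t.testBit (3 * x + y) = true → t.testBit (3 * y + x) = true → x = y) ∧
      ∀ x y z : Fin 3, t.testBit (3 * x + y) = true → t.testBit (3 * y + z) = true →
        t.testBit (3 * x + z) = true := by
    decide +kernel
  exact ⟨(h t ht).1, (h t ht).2.1, (h t ht).2.2⟩

end Permutations

section Algebra

variable (k : Type*) [Field k]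

/-- The algebra of relations on `Fin 3`. -/
abbrev RelAlg := MonoidAlgebra k (Set (Fin 3 × Fin 3))

/-- The basis element of the algebra of relations with the given code. -/
noncomputable def bas (n : ℕ) : RelAlg k := MonoidAlgebra.of k _ (ofCode n)

theorem bas_mulCode (a b : ℕ) : bas k (mulCode a b) = bas k a * bas k b := by
  rw [bas, ofCode_mulCode, map_mul]; rfl

theorem exists_bas_eq (R : Set (Fin 3 × Fin 3)) :
    ∃ n < 512, MonoidAlgebra.of k _ R = bas k n := by
  obtain ⟨n, hn, rfl⟩ := exists_ofCode_eq R
  exact ⟨n, hn, rfl⟩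

theorem mem_of_forall_bas_mem {N : Submodule k (RelAlg k)} (h : ∀ n < 512, bas k n ∈ N)
    (x : RelAlg k) : x ∈ N := by
  induction x using MonoidAlgebra.induction_on with
  | of R =>
    obtain ⟨n, hn, hR⟩ := exists_bas_eq k R
    exact hR ▸ h n hn
  | add a b ha hb => exact N.add_mem ha hb
  | smul r a ha => exact N.smul_mem r ha

/-- The ideal spanned by the relations that factor through a two-element set. -/
noncomputable def lowIdeal : Submodule k (RelAlg k) :=
  Submodule.span k (Set.range fun p : RelAlg k × RelAlg k => p.1 * bas k 17 * p.2)

variable {k}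

theorem mul_mul_mem_lowIdeal (x y : RelAlg k) : x * bas k 17 * y ∈ lowIdeal k :=
  Submodule.subset_span ⟨(x, y), rfl⟩

theorem mul_mem_lowIdeal_left (x : RelAlg k) {l : RelAlg k} (hl : l ∈ lowIdeal k) :
    x * l ∈ lowIdeal k := by
  induction hl using Submodule.span_induction with
  | mem l h =>
    obtain ⟨p, rfl⟩ := h
    simpa [mul_assoc] using mul_mul_mem_lowIdeal (x * p.1) p.2
  | zero => simp
  | add a b _ _ ha hb => rw [mul_add]; exact add_mem ha hb
  | smul r a _ ha => rw [mul_smul_comm]; exact Submodule.smul_mem _ r ha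

theorem mul_mem_lowIdeal_right (x : RelAlg k) {l : RelAlg k} (hl : l ∈ lowIdeal k) :
    l * x ∈ lowIdeal k := by
  induction hl using Submodule.span_induction with
  | mem l h =>
    obtain ⟨p, rfl⟩ := h
    simpa [mul_assoc] using mul_mul_mem_lowIdeal p.1 (p.2 * x)
  | zero => simp
  | add a b _ _ ha hb => rw [add_mul]; exact add_mem ha hb
  | smul r a _ ha => rw [smul_mul_assoc]; exact Submodule.smul_mem _ r ha

variable (k) in
theorem lowIdeal_eq_span_bas : lowIdeal k =
    Submodule.span k {x | ∃ u ∈ colCodes, ∃ v ∈ rowCodes, x = bas k u * bas k v} := by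
  apply le_antisymm
  · refine Submodule.span_le.2 ?_
    rintro _ ⟨⟨x, y⟩, rfl⟩
    refine mem_of_forall_bas_mem k (N := Submodule.comap
      (LinearMap.mulRight k (bas k 17 * y)) _) (fun m hm => ?_) x |> fun h => by
        simpa [mul_assoc] using h
    refine mem_of_forall_bas_mem k (N := Submodule.comap
      (LinearMap.mulLeft k (bas k m * bas k 17)) _) (fun n hn => ?_) y |> fun h => by
        simpa [mul_assoc] using h
    refine Submodule.subset_span ⟨_, mulCode_mem_colCodes m hm, _, mulCode_mem_rowCodes n hn, ?_⟩
    have : bas k 17 = bas k 17 * bas k 17 := bas_mulCode k 17 17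
    rw [LinearMap.mulLeft_apply, bas_mulCode, bas_mulCode]
    simp only [mul_assoc]
    rw [← mul_assoc (bas k 17), ← this]
  · refine Submodule.span_le.2 ?_
    rintro _ ⟨u, hu, v, hv, rfl⟩
    rw [← colCodes_mul u hu, bas_mulCode]
    exact mul_mul_mem_lowIdeal _ _

theorem testBit_foldl_or (L : List ℕ) (s n : ℕ) :
    (L.foldl (fun s n => s ||| 1 <<< n) s).testBit n = true ↔ s.testBit n = true ∨ n ∈ L := by
  induction L generalizing s with
  | nil => simp
  | cons a L ih =>
    rw [List.foldl_cons, ih, Nat.testBit_or, Nat.one_shiftLeft, Nat.testBit_two_pow]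
    simp only [Bool.or_eq_true, decide_eq_true_eq, List.mem_cons, or_assoc, eq_comm (a := a)]

theorem testBit_lowCodes {n : ℕ} : lowCodes.testBit n = true ↔
    ∃ u ∈ colCodes, ∃ v ∈ rowCodes, mulCode u v = n := by
  rw [lowCodes_eq_foldl, testBit_foldl_or]
  simp only [Nat.zero_testBit, Bool.false_eq_true, false_or, List.mem_flatMap, List.mem_map]

theorem bas_mem_lowIdeal {n : ℕ} (h : lowCodes.testBit n = true) : bas k n ∈ lowIdeal k := by
  obtain ⟨u, hu, v, hv, rfl⟩ := testBit_lowCodes.1 h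
  rw [lowIdeal_eq_span_bas]
  exact Submodule.subset_span ⟨u, hu, v, hv, bas_mulCode k u v⟩

theorem coeff_bas {m n : ℕ} (hm : m < 512) (hn : n < 512) :
    (bas k m).coeff (ofCode n) = if m = n then 1 else 0 := by
  classical
  rw [bas, MonoidAlgebra.of_apply, MonoidAlgebra.coeff_single, Finsupp.single_apply]
  exact if_congr ⟨ofCode_injOn hm hn, fun h => by rw [h]⟩ rfl rfl

theorem coeff_lowIdeal {l : RelAlg k} (hl : l ∈ lowIdeal k) {n : ℕ} (hn : n < 512)
    (h : lowCodes.testBit n = false) : l.coeff (ofCode n) = 0 := by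
  rw [lowIdeal_eq_span_bas] at hl
  induction hl using Submodule.span_induction with
  | mem l hl =>
    obtain ⟨u, hu, v, hv, rfl⟩ := hl
    rw [← bas_mulCode, coeff_bas (mulCode_lt _ _) hn, if_neg]
    rintro rfl
    exact Bool.false_ne_true (h.symm.trans (testBit_lowCodes.2 ⟨u, hu, v, hv, rfl⟩))
  | zero => simp
  | add a b _ _ ha hb => simp [ha, hb]
  | smul r a _ ha => simp [ha]

variable (k) in
/-- The identity element of `lowIdeal k`. -/
noncomputable def idem : RelAlg k := (idemPos.map (bas k)).sum - (idemNeg.map (bas k)).sum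

variable (k) in
theorem idem_mem : idem k ∈ lowIdeal k := by
  refine sub_mem (list_sum_mem ?_) (list_sum_mem ?_) <;>
  · intro x hx
    obtain ⟨n, hn, rfl⟩ := List.mem_map.1 hx
    exact bas_mem_lowIdeal (idem_low n (by simp [hn]))

theorem idem_mul_bas {u : ℕ} (hu : u ∈ colCodes) : idem k * bas k u = bas k u := by
  have := ((List.isPerm_iff.1 (idem_mul_col u hu)).map (bas k)).sum_eq
  simp only [List.map_map, List.map_cons, List.sum_cons, Function.comp_def, bas_mulCode,
    List.sum_map_mul_right] at this
  rw [idem, sub_mul, this, add_sub_cancel_right]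

theorem bas_mul_idem {v : ℕ} (hv : v ∈ rowCodes) : bas k v * idem k = bas k v := by
  have := ((List.isPerm_iff.1 (row_mul_idem v hv)).map (bas k)).sum_eq
  simp only [List.map_map, List.map_cons, List.sum_cons, Function.comp_def, bas_mulCode,
    List.sum_map_mul_left] at this
  rw [idem, mul_sub, this, add_sub_cancel_right]

theorem idem_mul {l : RelAlg k} (hl : l ∈ lowIdeal k) : idem k * l = l := by
  rw [lowIdeal_eq_span_bas] at hl
  induction hl using Submodule.span_induction with
  | mem l hl =>
    obtain ⟨u, hu, v, hv, rfl⟩ := hl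
    rw [← mul_assoc, idem_mul_bas hu]
  | zero => simp
  | add a b _ _ ha hb => rw [mul_add, ha, hb]
  | smul r a _ ha => rw [mul_smul_comm, ha]

theorem mul_idem {l : RelAlg k} (hl : l ∈ lowIdeal k) : l * idem k = l := by
  rw [lowIdeal_eq_span_bas] at hl
  induction hl using Submodule.span_induction with
  | mem l hl =>
    obtain ⟨u, hu, v, hv, rfl⟩ := hl
    rw [mul_assoc, bas_mul_idem hv]
  | zero => simp
  | add a b _ _ ha hb => rw [add_mul, ha, hb]
  | smul r a _ ha => rw [smul_mul_assoc, ha]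

theorem idem_comm (x : RelAlg k) : idem k * x = x * idem k := by
  rw [← mul_idem (mul_mem_lowIdeal_right x (idem_mem k)), mul_assoc,
    idem_mul (mul_mem_lowIdeal_left x (idem_mem k))]

end Algebra

section Radical

variable {k : Type*} [Field k]

open Classical in
theorem trace_regMatrix_bas {w : ℕ} (hw : w ∈ cornerCodes) :
    (MonoidAlgebra.lift k _ _ (regMatrix k (Set (Fin 3 × Fin 3))) (bas k w)).trace =
      cornerTrace.getD w 0 := by
  rw [bas, MonoidAlgebra.lift_of, trace_regMatrix, ← card_fixed_corner w hw]
  refine congrArg Nat.cast (Eq.symm ?_)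
  refine Finset.card_bij (fun m _ => ofCode m) (fun m hm => ?_) (fun m hm n hn h => ?_)
    fun R hR => ?_
  · simp only [Finset.mem_filter, Finset.mem_univ, true_and] at hm ⊢
    rw [← ofCode_mulCode, hm.2]
  · simp only [Finset.mem_filter, Finset.mem_range] at hm hn
    exact ofCode_injOn hm.1 hn.1 h
  · obtain ⟨m, hm, rfl⟩ := exists_ofCode_eq R
    simp only [Finset.mem_filter, Finset.mem_univ, true_and, ← ofCode_mulCode] at hR
    refine ⟨m, ?_, rfl⟩
    simpa [hm] using (ofCode_injOn hm (mulCode_lt _ _) hR).symm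

theorem corner_mem_span (x : RelAlg k) : bas k 17 * x * bas k 17 ∈
    Submodule.span k (Set.range fun i : Fin cornerCodes.length => bas k (cornerCodes.get i)) := by
  refine mem_of_forall_bas_mem k (N := Submodule.comap
    (LinearMap.mulLeft k (bas k 17) ∘ₗ LinearMap.mulRight k (bas k 17)) _) (fun n hn => ?_) x
    |> fun h => by simpa [mul_assoc] using h
  obtain ⟨i, hi⟩ := List.get_of_mem (mulCode_mem_cornerCodes _ (mulCode_mem_colCodes n hn))
  refine Submodule.subset_span ⟨i, ?_⟩
  change bas k (cornerCodes.get i) = bas k 17 * (bas k n * bas k 17)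
  rw [hi, bas_mulCode, bas_mulCode]

theorem eq_zero_of_corner [CharZero k] {c : RelAlg k}
    (hc : c ∈ Ideal.jacobson (⊥ : Ideal (RelAlg k))) (h : bas k 17 * c * bas k 17 = c) :
    c = 0 := by
  classical
  obtain ⟨y, hy⟩ := (Submodule.mem_span_range_iff_exists_fun k).1 (corner_mem_span c)
  rw [h] at hy
  have key : ∀ l, ∑ i, y i *
      (cornerTrace.getD (mulCode (cornerCodes.get i) (cornerCodes.get l)) 0 : k) = 0 := by
    intro l
    have := trace_eq_zero_of_mem_jacobson_bot k
      (MonoidAlgebra.lift k _ _ (regMatrix k (Set (Fin 3 × Fin 3))))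
      (mul_mem_jacobson_bot hc (bas k (cornerCodes.get l)))
    rw [← hy, Finset.sum_mul, map_sum, Matrix.trace_sum] at this
    rw [← this]
    refine Finset.sum_congr rfl fun i _ => ?_
    rw [smul_mul_assoc, ← bas_mulCode, map_smul, Matrix.trace_smul, smul_eq_mul,
      trace_regMatrix_bas (mulCode_corner _ (List.get_mem _ _) _ (List.get_mem _ _))]
  have hy0 : ∀ j, y j = 0 := by
    intro j
    have h1 : ∑ l : Fin cornerCodes.length, (∑ i, y i *
        (cornerTrace.getD (mulCode (cornerCodes.get i) (cornerCodes.get l)) 0 : k)) *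
          (((cornerInv.getD l []).getD j 0 : ℤ) : k) = 0 :=
      Finset.sum_eq_zero fun l _ => by rw [key l, zero_mul]
    simp only [Finset.sum_mul, mul_assoc] at h1
    rw [Finset.sum_comm] at h1
    simp only [← Finset.mul_sum] at h1
    have h2 : ∀ i, ∑ l : Fin cornerCodes.length,
        ((cornerTrace.getD (mulCode (cornerCodes.get i) (cornerCodes.get l)) 0 : ℕ) : k) *
          (((cornerInv.getD l []).getD j 0 : ℤ) : k) = if i = j then 252 else 0 := by
      intro i
      have := congrArg (Int.cast : ℤ → k) (cornerTrace_mul_cornerInv i j)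
      rw [Int.cast_sum] at this
      simpa only [Int.cast_mul, Int.cast_natCast, Int.cast_ite, Int.cast_zero, Int.cast_ofNat]
        using this
    simp only [h2, mul_ite, mul_zero, Finset.sum_ite_eq', Finset.mem_univ, if_true] at h1
    exact (mul_eq_zero.1 h1).resolve_right (by norm_num)
  rw [← hy]
  simp [hy0]

theorem low_mul_mul_low_eq_zero [CharZero k] {c : RelAlg k}
    (hc : c ∈ Ideal.jacobson (⊥ : Ideal (RelAlg k))) {l l' : RelAlg k} (hl : l ∈ lowIdeal k)
    (hl' : l' ∈ lowIdeal k) : l * c * l' = 0 := by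
  have hf : bas k 17 * bas k 17 = bas k 17 := (bas_mulCode k 17 17).symm
  have hcorner : ∀ q p, bas k 17 * (q * c * p) * bas k 17 = 0 := fun q p =>
    eq_zero_of_corner (mul_mem_jacobson_bot (Ideal.mul_mem_left _ _
      (mul_mem_jacobson_bot (Ideal.mul_mem_left _ _ hc) _)) _) (by
        rw [mul_assoc, mul_assoc _ (bas k 17), hf, ← mul_assoc, ← mul_assoc, hf])
  induction hl using Submodule.span_induction with
  | mem l h =>
    obtain ⟨⟨p, q⟩, rfl⟩ := h
    induction hl' using Submodule.span_induction with
    | mem l' h =>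
      obtain ⟨⟨p', q'⟩, rfl⟩ := h
      have := congrArg (fun z => p * z * q') (hcorner q p')
      simpa [mul_assoc] using this
    | zero => simp
    | add a b _ _ ha hb => rw [mul_add, ha, hb, add_zero]
    | smul r a _ ha => rw [mul_smul_comm, ha, smul_zero]
  | zero => simp
  | add a b _ _ ha hb => rw [add_mul, add_mul, ha, hb, add_zero]
  | smul r a _ ha => rw [smul_mul_assoc, smul_mul_assoc, ha, smul_zero]

theorem idem_mul_eq_zero [CharZero k] {c : RelAlg k}
    (hc : c ∈ Ideal.jacobson (⊥ : Ideal (RelAlg k))) : idem k * c = 0 := by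
  rw [← mul_idem (mul_mem_lowIdeal_right c (idem_mem k))]
  exact low_mul_mul_low_eq_zero hc (idem_mem k) (idem_mem k)

variable (k)

/-- The common kernel of the representations attached to the orders on `Fin 3`. -/
noncomputable def orderKer : Submodule k (RelAlg k) :=
  ⨅ t : {t // t ∈ orderCodes}, LinearMap.ker (orderRep k (isOrderRel_ofCode t.2)).toLinearMap

variable {k}

theorem mem_orderKer {x : RelAlg k} :
    x ∈ orderKer k ↔ ∀ t (ht : t ∈ orderCodes), orderRep k (isOrderRel_ofCode ht) x = 0 := by
  simp [orderKer]

theorem mul_mem_orderKer (y : RelAlg k) {x : RelAlg k} (hx : x ∈ orderKer k) :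
    y * x ∈ orderKer k :=
  mem_orderKer.2 fun t ht => by rw [map_mul, mem_orderKer.1 hx t ht, mul_zero]

theorem orderRep_bas {t : ℕ} (ht : t ∈ orderCodes) (a : ℕ) (α β : Equiv.Perm (Fin 3)) :
    orderRep k (isOrderRel_ofCode ht) (bas k a) α β =
      if betweenCode t (mulCode (mulCode (permCode α⁻¹) a) (permCode β)) then 1 else 0 := by
  classical
  rw [bas, orderRep_of]
  exact if_congr between_ofCode rfl rfl

theorem lowIdeal_le_orderKer : lowIdeal k ≤ orderKer k := by
  refine Submodule.span_le.2 ?_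
  rintro _ ⟨⟨p, q⟩, rfl⟩
  refine mem_orderKer.2 fun t ht => ?_
  have : orderRep k (isOrderRel_ofCode ht) (bas k 17) = 0 := by
    classical
    ext α β
    rw [bas, orderRep_of, if_neg, Matrix.zero_apply]
    intro h
    have h17 : ∀ y : Fin 3, (17).testBit (3 * (2 : Fin 3) + y : ℕ) = false := by decide
    have := h.1 (α⁻¹ 2)
    rw [← Equiv.Perm.mul_apply, mul_inv_cancel] at this
    exact Bool.false_ne_true ((h17 _).symm.trans this)
  simp [this]

variable (k) in
/-- The difference of the basis elements given by a pair in `badCodes`. -/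
noncomputable def badDiff (i : Fin badCodes.length) : RelAlg k :=
  bas k (badCodes.get i).1 - bas k (badCodes.get i).2

theorem badDiff_mem_orderKer (i : Fin badCodes.length) : badDiff k i ∈ orderKer k := by
  refine mem_orderKer.2 fun t ht => ?_
  ext α β
  rw [badDiff, map_sub, Matrix.sub_apply, orderRep_bas ht, orderRep_bas ht,
    betweenCode_bad _ (List.get_mem _ i) _ (permCode_mem _) _ (permCode_mem _) _ ht, sub_self,
    Matrix.zero_apply]

theorem sum_sub_sum_filter_mem (L : List ℕ) :
    (L.map (bas k)).sum - ((L.filter (!lowCodes.testBit ·)).map (bas k)).sum ∈ lowIdeal k := by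
  induction L with
  | nil => simp
  | cons a L ih =>
    by_cases h : lowCodes.testBit a = true
    · rw [List.filter_cons_of_neg (by simp [h]), List.map_cons, List.sum_cons, add_sub_assoc]
      exact add_mem (bas_mem_lowIdeal h) ih
    · rw [List.filter_cons_of_pos (by simpa using h), List.map_cons, List.sum_cons, List.map_cons,
        List.sum_cons, add_sub_add_left_eq_sub]
      exact ih

theorem badDiff_mul_badDiff (i j : Fin badCodes.length) :
    badDiff k i * badDiff k j ∈ lowIdeal k := by
  have h := ((List.isPerm_iff.1 (bad_mul_bad _ (List.get_mem _ i) _ (List.get_mem _ j))).map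
    (bas k)).sum_eq
  have h1 := sum_sub_sum_filter_mem (k := k) [mulCode (badCodes.get i).1 (badCodes.get j).1,
    mulCode (badCodes.get i).2 (badCodes.get j).2]
  have h2 := sum_sub_sum_filter_mem (k := k) [mulCode (badCodes.get i).1 (badCodes.get j).2,
    mulCode (badCodes.get i).2 (badCodes.get j).1]
  rw [h] at h1
  have h3 := sub_mem h1 h2
  rw [sub_sub_sub_cancel_right] at h3
  simp only [List.map_cons, List.map_nil, List.sum_cons, List.sum_nil, add_zero,
    bas_mulCode] at h3
  convert h3 using 1
  rw [badDiff, badDiff]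
  noncomm_ring

variable (k) in
/-- The span of `lowIdeal k` and the elements `badDiff k i`. -/
noncomputable def lowBad : Submodule k (RelAlg k) :=
  lowIdeal k ⊔ Submodule.span k (Set.range (badDiff k))

theorem lowBad_le_orderKer : lowBad k ≤ orderKer k :=
  sup_le lowIdeal_le_orderKer (Submodule.span_le.2 (by
    rintro _ ⟨i, rfl⟩
    exact badDiff_mem_orderKer i))

theorem lowBad_mul_lowBad : lowBad k * lowBad k ≤ lowIdeal k := by
  rw [lowBad, Submodule.sup_mul, Submodule.mul_sup (Submodule.span _ _), Submodule.span_mul_span]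
  refine sup_le (Submodule.mul_le.2 fun m hm n _ => mul_mem_lowIdeal_right n hm)
    (sup_le (Submodule.mul_le.2 fun m _ n hn => mul_mem_lowIdeal_left m hn)
      (Submodule.span_le.2 ?_))
  · rintro _ ⟨_, ⟨i, rfl⟩, _, ⟨j, rfl⟩, rfl⟩
    exact badDiff_mul_badDiff i j

variable (k) in
/-- The basis elements of the form order times permutation. -/
noncomputable def orderPerm (p : Fin orderCodes.length × Equiv.Perm (Fin 3)) : RelAlg k :=
  bas k (mulCode (orderCodes.get p.1) (permCode p.2))

theorem mem_lowBad_sup_span (x : RelAlg k) :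
    x ∈ lowBad k ⊔ Submodule.span k (Set.range (orderPerm k)) := by
  have aux : ∀ n < 512, n ∉ badCodes.map Prod.fst →
      bas k n ∈ lowBad k ⊔ Submodule.span k (Set.range (orderPerm k)) := by
    intro n hn hbad
    rcases low_or_bad_or_order n hn with h | h | h
    · exact Submodule.mem_sup_left (Submodule.mem_sup_left (bas_mem_lowIdeal h))
    · exact absurd h hbad
    · obtain ⟨t, ht, h⟩ := List.mem_flatMap.1 h
      obtain ⟨s, hs, rfl⟩ := List.mem_map.1 h
      obtain ⟨i, rfl⟩ := List.get_of_mem ht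
      obtain ⟨σ, rfl⟩ := exists_permCode_eq s hs
      exact Submodule.mem_sup_right (Submodule.subset_span ⟨(i, σ), rfl⟩)
  refine mem_of_forall_bas_mem k (fun n hn => ?_) x
  by_cases hbad : n ∈ badCodes.map Prod.fst
  · obtain ⟨p, hp, rfl⟩ := List.mem_map.1 hbad
    rw [← sub_add_cancel (bas k p.1) (bas k p.2)]
    refine add_mem ?_ (aux _ (bad_not_low p hp).2.2 (bad_disjoint p hp))
    obtain ⟨i, rfl⟩ := List.get_of_mem hp
    exact Submodule.mem_sup_left (Submodule.mem_sup_right (Submodule.subset_span ⟨i, rfl⟩))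
  · exact aux n hn hbad

theorem mulCode_perm_order_perm (t : ℕ) (σ τ : Equiv.Perm (Fin 3)) :
    mulCode (mulCode (permCode 1⁻¹) (mulCode t (permCode σ))) (permCode τ) =
      mulCode t (permCode (σ * τ)) := by
  refine ofCode_injOn (mulCode_lt _ _) (mulCode_lt _ _) ?_
  rw [inv_one, permCode_one, ← mulCode_permCode]
  simp only [ofCode_mulCode, ofCode_273, one_mul, mul_assoc]

theorem orderRep_orderPerm (i : Fin orderCodes.length) (τ : Equiv.Perm (Fin 3))
    (p : Fin orderCodes.length × Equiv.Perm (Fin 3)) :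
    orderRep k (isOrderRel_ofCode (List.get_mem orderCodes i)) (orderPerm k p) 1 τ⁻¹ =
      if betweenCode (orderCodes.get i)
        (mulCode (orderCodes.get p.1) (permCode (p.2 * τ⁻¹))) then 1 else 0 := by
  rw [orderPerm, orderRep_bas (List.get_mem orderCodes i), mulCode_perm_order_perm]

theorem eq_zero_of_sum_orderPerm_mem
    {y : Fin orderCodes.length × Equiv.Perm (Fin 3) → k}
    (h : ∑ p, y p • orderPerm k p ∈ orderKer k) (i : Fin orderCodes.length)
    (τ : Equiv.Perm (Fin 3)) : y (i, τ) = 0 := by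
  induction i using WellFoundedLT.induction generalizing τ with
  | ind i ih =>
    have key := congrFun (congrFun (mem_orderKer.1 h _ (List.get_mem orderCodes i)) 1) τ⁻¹
    simp only [map_sum, map_smul, Matrix.sum_apply, Matrix.smul_apply, orderRep_orderPerm,
      smul_eq_mul, mul_ite, mul_one, mul_zero, Matrix.zero_apply] at key
    rw [Finset.sum_eq_single (i, τ)] at key
    · rwa [mul_inv_cancel, permCode_one, if_pos] at key
      have : mulCode (orderCodes.get i) 273 = orderCodes.get i := by
        have : ∀ t ∈ orderCodes, mulCode t 273 = t := by decide +kernel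
        exact this _ (List.get_mem _ _)
      rw [this]
      exact betweenCode_self _ (List.get_mem _ _)
    · rintro ⟨j, σ⟩ - hne
      refine ite_eq_right_iff.2 fun hb => ?_
      obtain ⟨h1, h2⟩ := betweenCode_order i j _ (permCode_mem _) hb
      have hσ : σ = τ := mul_inv_eq_one.1 (permCode_eq_273 _ h1)
      exact ih j (lt_of_le_of_ne h2 fun hji => hne (by rw [hji, hσ])) σ
    · simp

theorem orderKer_le_lowBad : orderKer k ≤ lowBad k := by
  intro x hx
  obtain ⟨n, hn, o, ho, rfl⟩ := Submodule.mem_sup.1 (mem_lowBad_sup_span x)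
  obtain ⟨y, rfl⟩ := (Submodule.mem_span_range_iff_exists_fun k).1 ho
  have h := eq_zero_of_sum_orderPerm_mem
    ((Submodule.add_mem_iff_right _ (lowBad_le_orderKer hn)).1 hx)
  rwa [Finset.sum_eq_zero fun p _ => by rw [h p.1 p.2, zero_smul], add_zero]

variable (k) in
/-- A basis of the Jacobson radical of the algebra of relations on `Fin 3`. -/
noncomputable def radBasis (i : Fin badCodes.length) : RelAlg k :=
  badDiff k i - idem k * badDiff k i

theorem mem_jacobson_bot_of_forall_sq_eq_zero {A : Type*} [Ring A] {x : A}
    (h : ∀ y, (y * x) * (y * x) = 0) : x ∈ Ideal.jacobson (⊥ : Ideal A) := by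
  refine Ideal.mem_jacobson_iff.2 fun y => ⟨1 - y * x, ?_⟩
  have : (1 - y * x) * y * x + (1 - y * x) - 1 = -((y * x) * (y * x)) := by noncomm_ring
  rw [this, h]
  simp

theorem radBasis_mem (i : Fin badCodes.length) :
    radBasis k i ∈ Ideal.jacobson (⊥ : Ideal (RelAlg k)) := by
  refine mem_jacobson_bot_of_forall_sq_eq_zero fun y => ?_
  have hker : radBasis k i ∈ orderKer k :=
    sub_mem (badDiff_mem_orderKer i) (mul_mem_orderKer _ (badDiff_mem_orderKer i))
  have hlow : (y * radBasis k i) * (y * radBasis k i) ∈ lowIdeal k :=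
    lowBad_mul_lowBad (Submodule.mul_mem_mul (orderKer_le_lowBad (mul_mem_orderKer y hker))
      (orderKer_le_lowBad (mul_mem_orderKer y hker)))
  have hzero : idem k * radBasis k i = 0 := by
    rw [radBasis, mul_sub, ← mul_assoc, idem_mul (idem_mem k), sub_self]
  rw [← idem_mul hlow]
  simp only [← mul_assoc]
  rw [idem_comm, mul_assoc y, hzero]
  simp

theorem jacobson_bot_eq_span [CharZero k] :
    Submodule.restrictScalars k (Ideal.jacobson (⊥ : Ideal (RelAlg k))) =
      Submodule.span k (Set.range (radBasis k)) := by
  apply le_antisymm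
  · intro a ha
    replace ha : a ∈ Ideal.jacobson (⊥ : Ideal (RelAlg k)) := ha
    have hK : a ∈ lowBad k := orderKer_le_lowBad
      (mem_orderKer.2 fun t ht => orderRep_eq_zero_of_mem_jacobson_bot k _ ha)
    obtain ⟨l, hl, b, hb, rfl⟩ := Submodule.mem_sup.1 hK
    obtain ⟨y, rfl⟩ := (Submodule.mem_span_range_iff_exists_fun k).1 hb
    rw [Submodule.mem_span_range_iff_exists_fun]
    refine ⟨y, ?_⟩
    have h0 := idem_mul_eq_zero ha
    rw [mul_add, idem_mul hl, Finset.mul_sum] at h0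
    rw [eq_neg_of_add_eq_zero_left h0]
    simp only [radBasis, smul_sub, Finset.sum_sub_distrib, mul_smul_comm]
    abel
  · refine Submodule.span_le.2 ?_
    rintro _ ⟨i, rfl⟩
    exact radBasis_mem i

theorem coeff_radBasis (i j : Fin badCodes.length) :
    (radBasis k i).coeff (ofCode (badCodes.get j).1) = if i = j then 1 else 0 := by
  obtain ⟨hj, hj', -⟩ := bad_not_low _ (List.get_mem badCodes j)
  obtain ⟨-, hi, hi'⟩ := bad_not_low _ (List.get_mem badCodes i)
  have h1 : (badCodes.get i).1 = (badCodes.get j).1 ↔ i = j := by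
    have := bad_nodup.injective_get
    refine ⟨fun h => ?_, fun h => by rw [h]⟩
    have := @this (i.cast (by simp)) (j.cast (by simp)) (by simpa using h)
    simpa [Fin.ext_iff] using this
  have h2 : (badCodes.get i).2 ≠ (badCodes.get j).1 := fun h =>
    bad_disjoint _ (List.get_mem badCodes i) (h ▸ List.mem_map_of_mem (List.get_mem _ _))
  rw [radBasis, badDiff, MonoidAlgebra.coeff_sub, Finsupp.sub_apply, MonoidAlgebra.coeff_sub,
    Finsupp.sub_apply, coeff_bas hi hj', coeff_bas hi' hj', if_neg h2, sub_zero,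
    coeff_lowIdeal (mul_mem_lowIdeal_right _ (idem_mem k)) hj' hj, sub_zero]
  exact if_congr h1 rfl rfl

variable (k) in
theorem linearIndependent_radBasis : LinearIndependent k (radBasis k) := by
  refine Fintype.linearIndependent_iff.2 fun y hy j => ?_
  have := congrArg (fun x => x.coeff (ofCode (badCodes.get j).1)) hy
  simpa only [MonoidAlgebra.coeff_sum, MonoidAlgebra.coeff_smul, Finsupp.finsetSum_apply,
    Finsupp.smul_apply, coeff_radBasis, smul_eq_mul, mul_ite, mul_one, mul_zero,
    Finset.sum_ite_eq', Finset.mem_univ, if_true, MonoidAlgebra.coeff_zero,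
    Finsupp.zero_apply] using this

variable (k) in
theorem finrank_jacobson_bot [CharZero k] :
    Module.finrank k (Submodule.restrictScalars k (Ideal.jacobson (⊥ : Ideal (RelAlg k)))) =
      42 := by
  rw [jacobson_bot_eq_span, finrank_span_eq_card (linearIndependent_radBasis k), Fintype.card_fin]
  rfl

end Radical

/-- The isomorphism of monoids of relations induced by an equivalence. -/
def relMulEquiv {X Y : Type*} (e : X ≃ Y) : Set (X × X) ≃* Set (Y × Y) where
  toEquiv := Equiv.Set.congr (e.prodCongr e)
  map_mul' R S := by
    ext ⟨z, x⟩
    constructor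
    · rintro ⟨⟨z, x⟩, ⟨y, h1, h2⟩, h⟩
      obtain ⟨rfl, rfl⟩ := Prod.mk.inj h
      exact ⟨e y, ⟨_, h1, rfl⟩, ⟨_, h2, rfl⟩⟩
    · rintro ⟨_, ⟨⟨z, y⟩, h1, h⟩, ⟨⟨y', x⟩, h2, h'⟩⟩
      obtain ⟨rfl, rfl⟩ := Prod.mk.inj h
      obtain ⟨hy, rfl⟩ := Prod.mk.inj h'
      obtain rfl := e.injective hy
      exact ⟨(z, x), ⟨_, h1, h2⟩, rfl⟩

theorem finrank_jacobson_bot_congr {k A B : Type*} [Field k] [Ring A] [Ring B] [Algebra k A]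
    [Algebra k B] (e : A ≃ₐ[k] B) :
    Module.finrank k (Submodule.restrictScalars k (Ideal.jacobson (⊥ : Ideal A))) =
      Module.finrank k (Submodule.restrictScalars k (Ideal.jacobson (⊥ : Ideal B))) := by
  have h : Submodule.restrictScalars k (Ideal.jacobson (⊥ : Ideal A)) =
      (Submodule.restrictScalars k (Ideal.jacobson (⊥ : Ideal B))).comap
        e.toLinearEquiv.toLinearMap := by
    have h1 := Ideal.comap_jacobson_of_surjective (f := (e : A →+* B)) e.surjective (K := ⊥)
    rw [← RingHom.ker_eq_comap_bot,
      (RingHom.injective_iff_ker_eq_bot (e : A →+* B)).1 e.injective] at h1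
    rw [← h1]
    rfl
  rw [h]
  exact (e.toLinearEquiv.ofSubmodule' _).finrank_eq

/-- For a field `k` of characteristic zero and a set `X` with 3 elements, the Jacobson
radical `J(𝓡_X)` of the algebra of relations `𝓡_X = k𝓒(X,X)` has dimension 42
as a `k`-vector space. -/
theorem relAlgebra_jacobson_dim (k : Type) [Field k] [CharZero k]
    (X : Type) [Fintype X] (hX : Fintype.card X = 3) :
    Module.finrank k
      (Submodule.restrictScalars k
        (Ideal.jacobson (⊥ : Ideal (MonoidAlgebra k (Set (X × X)))))) = 42 := by
  obtain ⟨e⟩ : Nonempty (X ≃ Fin 3) := ⟨Fintype.equivFinOfCardEq hX⟩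
  rw [finrank_jacobson_bot_congr (MonoidAlgebra.domCongr k k (relMulEquiv e))]
  exact finrank_jacobson_bot k
end

section
/- Let k be an algebraically closed field of characteristic zero and X a finite set with |X| = n. Then the number of isomorphism classes of simple modules over the monoid algebra 𝓡_X = k𝓒(X,X) of the monoid of relations on X equals Σ_{e=0}^{n} Σ_{[R]} c(Aut(E,R)), where, for each e, E denotes a fixed e-element set, [R] runs over a set of representatives of the Σ_E-conjugacy classes of partial order relations R on E (equivalently, isomorphism classes of posets with e elements), Aut(E,R) is the stabilizer of R under the conjugation action of the symmetric group Σ_E, and c(G) denotes the number of conjugacy classes of the finite group G. -/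
/-- The conjugate relation `ᵠR = Δ_σ R Δ_{σ⁻¹} = {(σ(x),σ(y)) | (x,y) ∈ R}`. -/
def conjRel {E : Type} (σ : Equiv.Perm E) (R : Set (E × E)) : Set (E × E) :=
  {p | ∃ q ∈ R, p = (σ q.1, σ q.2)}

theorem conjRel_one {E : Type} (R : Set (E × E)) : conjRel (1 : Equiv.Perm E) R = R := by
  ext p
  constructor
  · rintro ⟨q, hq, rfl⟩
    exact hq
  · intro hp
    exact ⟨p, hp, rfl⟩

theorem conjRel_mul {E : Type} (σ τ : Equiv.Perm E) (R : Set (E × E)) :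
    conjRel (σ * τ) R = conjRel σ (conjRel τ R) := by
  ext p
  constructor
  · rintro ⟨q, hq, rfl⟩
    exact ⟨(τ q.1, τ q.2), ⟨q, hq, rfl⟩, rfl⟩
  · rintro ⟨r, ⟨q, hq, rfl⟩, rfl⟩
    exact ⟨q, hq, rfl⟩

/-- The stabilizer `Aut(E,R)` of a relation `R` under the conjugation action of `Σ_E`. -/
def autRel (E : Type) (R : Set (E × E)) : Subgroup (Equiv.Perm E) where
  carrier := {σ | conjRel σ R = R}
  one_mem' := conjRel_one R
  mul_mem' := by
    intro a b ha hb
    show conjRel (a * b) R = R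
    rw [conjRel_mul, hb, ha]
  inv_mem' := by
    intro a ha
    show conjRel a⁻¹ R = R
    conv_lhs => rw [← ha]
    rw [← conjRel_mul, inv_mul_cancel, conjRel_one]

/-- A relation `R ⊆ E × E` is a partial order relation: reflexive, antisymmetric
and transitive. -/
def IsOrderRel {E : Type} (R : Set (E × E)) : Prop :=
  (∀ x, (x, x) ∈ R) ∧ (∀ x y, (x, y) ∈ R → (y, x) ∈ R → x = y) ∧
  (∀ x y z, (x, y) ∈ R → (y, z) ∈ R → (x, z) ∈ R)

/-- A left ideal is maximal iff it is proper and every element outside it is left invertible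
modulo it. -/
theorem isCoatom_iff_exists_mul_sub_one_mem {R : Type*} [Ring R] (I : Submodule R R) :
    IsCoatom I ↔ (1 : R) ∉ I ∧ ∀ a, a ∉ I → ∃ b, b * a - 1 ∈ I := by
  constructor
  · intro h
    refine ⟨fun h1 => h.1 ((Ideal.eq_top_iff_one I).2 h1), fun a ha => ?_⟩
    have hlt : I < I ⊔ Submodule.span R {a} :=
      lt_of_le_of_ne le_sup_left fun he =>
        ha (he ▸ Submodule.mem_sup_right (Submodule.mem_span_singleton_self a))
    have h1 : (1 : R) ∈ I ⊔ Submodule.span R {a} := by rw [h.2 _ hlt]; trivial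
    obtain ⟨x, hx, y, hy, hxy⟩ := Submodule.mem_sup.1 h1
    obtain ⟨b, rfl⟩ := Submodule.mem_span_singleton.1 hy
    refine ⟨b, ?_⟩
    have : b * a - 1 = -x := by rw [← hxy, smul_eq_mul]; abel
    rw [this]
    exact I.neg_mem hx
  · rintro ⟨h1, h⟩
    refine ⟨fun he => h1 (he ▸ trivial), fun J hJ => ?_⟩
    obtain ⟨a, haJ, haI⟩ := Set.exists_of_ssubset hJ
    obtain ⟨b, hb⟩ := h a haI
    refine (Ideal.eq_top_iff_one J).2 ?_
    have : (1 : R) = b • a - (b * a - 1) := by rw [smul_eq_mul]; abel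
    rw [this]
    exact J.sub_mem (J.smul_mem b haJ) (hJ.le hb)

/-- A simple module is the quotient of the ring by the annihilator of a nonzero vector. -/
theorem nonempty_linearEquiv_quotient_of_annihilator {R V : Type*} [Ring R] [AddCommGroup V]
    [Module R V] [IsSimpleModule R V] {v : V} (hv : v ≠ 0) (L : Submodule R R)
    (hL : ∀ a : R, a • v = 0 ↔ a ∈ L) : Nonempty (V ≃ₗ[R] R ⧸ L) := by
  have hk : LinearMap.ker (LinearMap.toSpanSingleton R V v) = L := by
    ext a; simpa using hL a
  subst hk
  exact ⟨(LinearMap.quotKerEquivOfSurjective _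
    (IsSimpleModule.toSpanSingleton_surjective R hv)).symm⟩

/-- Isomorphisms onto a simple cyclic module, described through left ideals. -/
theorem nonempty_quotient_linearEquiv_iff {R : Type*} [Ring R] {L L' : Submodule R R}
    (hL : IsCoatom L) (hL' : IsCoatom L') :
    Nonempty ((R ⧸ L) ≃ₗ[R] R ⧸ L') ↔ ∃ s, s ∉ L' ∧ ∀ t, t * s ∈ L' ↔ t ∈ L := by
  have hs : ∀ s t : R, t • L'.mkQ s = 0 ↔ t * s ∈ L' := fun s t => by
    rw [← map_smul, Submodule.mkQ_apply, Submodule.Quotient.mk_eq_zero, smul_eq_mul]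
  constructor
  · rintro ⟨e⟩
    obtain ⟨s, hs'⟩ := L'.mkQ_surjective (e (L.mkQ 1))
    have key : ∀ t, t * s ∈ L' ↔ t ∈ L := fun t => by
      rw [← hs, hs', ← map_smul, LinearEquiv.map_eq_zero_iff, ← map_smul, Submodule.mkQ_apply,
        Submodule.Quotient.mk_eq_zero, smul_eq_mul, mul_one]
    refine ⟨s, fun hm => ?_, key⟩
    exact ((isCoatom_iff_exists_mul_sub_one_mem L).1 hL).1 ((key 1).1 (by rwa [one_mul]))
  · rintro ⟨s, hsL, h⟩
    have : IsSimpleModule R (R ⧸ L') := isSimpleModule_iff_isCoatom.2 hL'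
    have hv : L'.mkQ s ≠ 0 := by
      rwa [Ne, Submodule.mkQ_apply, Submodule.Quotient.mk_eq_zero]
    obtain ⟨e⟩ := nonempty_linearEquiv_quotient_of_annihilator hv L
      fun a => (hs s a).trans (h a)
    exact ⟨e.symm⟩

/-- A family of maximal left ideals whose quotients represent every isomorphism class of
simple modules exactly once. -/
structure IsSimpleReps {R κ : Type*} [Ring R] (L : κ → Submodule R R) : Prop where
  isCoatom : ∀ i, IsCoatom (L i)
  injective : ∀ i j s, s ∉ L j → (∀ t, t * s ∈ L j ↔ t ∈ L i) → i = j
  exists_rep : ∀ I : Submodule R R, IsCoatom I → ∃ i s, s ∉ I ∧ ∀ t, t * s ∈ I ↔ t ∈ L i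

/-- The left ideal of the elements whose `i`-th matrix component has vanishing column `0`. -/
def columnIdeal {k R ι : Type*} [Field k] [Ring R] [Algebra k R] {d : ι → ℕ}
    [∀ i, NeZero (d i)] (φ : R ≃ₐ[k] Π i, Matrix (Fin (d i)) (Fin (d i)) k) (i : ι) :
    Submodule R R where
  carrier := {a | ∀ r, φ a i r 0 = 0}
  zero_mem' := by simp
  add_mem' := by
    intro a b ha hb r
    simp [ha r, hb r]
  smul_mem' := by
    intro c a ha r
    simp only [Set.mem_ofPred_eq] at ha
    simp [Matrix.mul_apply, ha]

theorem mem_columnIdeal {k R ι : Type*} [Field k] [Ring R] [Algebra k R] {d : ι → ℕ}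
    [∀ i, NeZero (d i)] (φ : R ≃ₐ[k] Π i, Matrix (Fin (d i)) (Fin (d i)) k) (i : ι) (a : R) :
    a ∈ columnIdeal φ i ↔ ∀ r, φ a i r 0 = 0 := Iff.rfl

theorem isCoatom_columnIdeal {k R ι : Type*} [Field k] [Ring R] [Algebra k R] [DecidableEq ι]
    {d : ι → ℕ} [∀ i, NeZero (d i)] (φ : R ≃ₐ[k] Π i, Matrix (Fin (d i)) (Fin (d i)) k) (i : ι) :
    IsCoatom (columnIdeal φ i) := by
  rw [isCoatom_iff_exists_mul_sub_one_mem]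
  refine ⟨fun h => by simpa using h 0, fun a ha => ?_⟩
  simp only [mem_columnIdeal, not_forall] at ha
  obtain ⟨r, hr⟩ := ha
  refine ⟨φ.symm (Pi.single i (Matrix.single 0 r (φ a i r 0)⁻¹)), fun r' => ?_⟩
  by_cases h : r' = 0
  · subst h; simp [hr]
  · simp [Matrix.one_apply_ne h, Matrix.single_mul_apply_of_ne, h]

theorem isSimpleReps_columnIdeal {k R ι : Type*} [Field k] [Ring R] [Algebra k R] [Fintype ι]
    [DecidableEq ι] {d : ι → ℕ} [∀ i, NeZero (d i)]
    (φ : R ≃ₐ[k] Π i, Matrix (Fin (d i)) (Fin (d i)) k) : IsSimpleReps (columnIdeal φ) where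
  isCoatom := isCoatom_columnIdeal φ
  injective := by
    intro i j s hs h
    by_contra hij
    refine hs ?_
    have h1 : φ.symm (Pi.single j 1) ∈ columnIdeal φ i := by
      simp [mem_columnIdeal, Pi.single_eq_of_ne hij]
    have h2 := (h _).2 h1
    simpa [mem_columnIdeal] using h2
  exists_rep := by
    intro I hI
    obtain ⟨h1, h2⟩ := (isCoatom_iff_exists_mul_sub_one_mem I).1 hI
    obtain ⟨i, r, hir⟩ : ∃ i r, φ.symm (Pi.single i (Matrix.single r r 1)) ∉ I := by
      by_contra! hcon
      refine h1 ?_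
      have : (1 : R) = ∑ i, ∑ r, φ.symm (Pi.single i (Matrix.single r r 1)) := by
        apply φ.injective
        ext i a b
        simp only [map_sum, AlgEquiv.apply_symm_apply, map_one]
        rw [Finset.sum_apply, Finset.sum_eq_single i]
        · rcases eq_or_ne a b with rfl | hab
          · simp [Finset.sum_apply, Matrix.sum_apply, Matrix.single_apply]
          · have (r : Fin (d i)) : ¬ (r = a ∧ r = b) := fun h => hab (h.1.symm.trans h.2)
            simp [Finset.sum_apply, Matrix.sum_apply, hab, this]
        · intro j _ hj
          simp [Finset.sum_apply, Pi.single_eq_of_ne hj.symm]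
        · simp
      rw [this]
      exact I.sum_mem fun i _ => I.sum_mem fun r _ => hcon i r
    set u : R := φ.symm (Pi.single i (Matrix.single 0 r 1)) with hu
    have hprod : φ.symm (Pi.single i (Matrix.single r 0 1)) * u =
        φ.symm (Pi.single i (Matrix.single r r 1)) := by
      rw [hu, ← map_mul, ← Pi.single_mul]; simp
    have huI : u ∉ I := fun h => hir (hprod ▸ I.smul_mem _ h)
    have hle : ∀ a ∈ columnIdeal φ i, a * u ∈ I := by
      intro a ha
      have h0 : a * φ.symm (Pi.single i (Matrix.single 0 0 1)) = 0 := by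
        apply φ.injective
        rw [map_mul, AlgEquiv.apply_symm_apply, map_zero]
        ext j p q
        rcases eq_or_ne j i with rfl | hj
        · by_cases hq : q = 0
          · subst hq; simpa using ha p
          · simp [hq]
        · simp [Pi.single_eq_of_ne hj]
      have hu0 : u = φ.symm (Pi.single i (Matrix.single 0 0 1)) * u := by
        rw [hu, ← map_mul, ← Pi.single_mul]; simp
      rw [hu0, ← mul_assoc, h0, zero_mul]
      exact I.zero_mem
    refine ⟨i, u, huI, fun t => ⟨fun ht => ?_, hle t⟩⟩
    by_contra htL
    obtain ⟨b, hb⟩ := ((isCoatom_iff_exists_mul_sub_one_mem _).1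
      (isCoatom_columnIdeal φ i)).2 t htL
    refine huI ?_
    have hd : u = b • (t * u) - (b * t - 1) * u := by
      rw [smul_eq_mul]; noncomm_ring
    rw [hd]
    exact I.sub_mem (I.smul_mem b ht) (hle _ hb)

/-- The linear embedding of class functions into the group algebra. -/
noncomputable def classFunctionSum (k G : Type*) [Field k] [Group G] [Fintype G] :
    (ConjClasses G → k) →ₗ[k] MonoidAlgebra k G where
  toFun c := ∑ g, MonoidAlgebra.single g (c (ConjClasses.mk g))
  map_add' c c' := by simp [Finset.sum_add_distrib]
  map_smul' r c := by simp [Finset.smul_sum]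

theorem coeff_classFunctionSum {k G : Type*} [Field k] [Group G] [Fintype G]
    (c : ConjClasses G → k) (g : G) :
    (classFunctionSum k G c).coeff g = c (ConjClasses.mk g) := by
  classical
  simp [classFunctionSum, MonoidAlgebra.coeff_sum, Finsupp.finsetSum_apply, Finsupp.single_apply]

theorem range_classFunctionSum (k G : Type*) [Field k] [Group G] [Fintype G] :
    LinearMap.range (classFunctionSum k G) =
      (Subalgebra.center k (MonoidAlgebra k G)).toSubmodule := by
  ext a
  simp only [LinearMap.mem_range, Subalgebra.mem_toSubmodule, Subalgebra.mem_center_iff]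
  constructor
  · rintro ⟨c, rfl⟩ b
    induction b using MonoidAlgebra.induction_linear with
    | zero => simp
    | add x y hx hy => rw [add_mul, mul_add, hx, hy]
    | single g r =>
      ext h
      rw [MonoidAlgebra.coeff_single_mul_apply, MonoidAlgebra.coeff_mul_single_apply,
        coeff_classFunctionSum, coeff_classFunctionSum, mul_comm]
      congr 2
      exact ConjClasses.mk_eq_mk_iff_isConj.2 (isConj_iff.2 ⟨g, by group⟩)
  · intro ha
    have hc : ∀ g h : G, IsConj g h → a.coeff g = a.coeff h := by
      intro g h hgh
      obtain ⟨x, rfl⟩ := isConj_iff.1 hgh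
      have := congrArg (fun y => y.coeff (x * g)) (ha (MonoidAlgebra.single x 1))
      simpa [MonoidAlgebra.coeff_single_mul_apply, MonoidAlgebra.coeff_mul_single_apply] using this
    refine ⟨fun q => Quotient.liftOn q a.coeff hc, ?_⟩
    ext g
    rw [coeff_classFunctionSum]
    rfl

/-- The dimension of the center of a product of matrix algebras is the number of factors. -/
theorem finrank_center_of_algEquiv_pi_matrix {k R ι : Type*} [Field k] [Ring R] [Algebra k R]
    [Fintype ι] {d : ι → ℕ} [∀ i, NeZero (d i)]
    (φ : R ≃ₐ[k] Π i, Matrix (Fin (d i)) (Fin (d i)) k) :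
    Module.finrank k (Subalgebra.center k R).toSubmodule = Fintype.card ι := by
  classical
  let ψ : (ι → k) →ₗ[k] R :=
    φ.symm.toLinearMap ∘ₗ
      { toFun := fun c i => Matrix.scalar _ (c i)
        map_add' := fun c c' => by ext; simp [Matrix.diagonal_apply, ite_add_ite]
        map_smul' := fun r c => by ext; simp [Matrix.diagonal_apply] }
  have hψ : ∀ c, φ (ψ c) = fun i => Matrix.scalar _ (c i) := fun c => by simp [ψ]
  have hinj : Function.Injective ψ := by
    intro c c' h
    ext i
    have := congrFun (congrFun (congrFun ((hψ c).symm.trans ((congrArg φ h).trans (hψ c'))) i) 0) 0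
    simpa using this
  have hrange : LinearMap.range ψ = (Subalgebra.center k R).toSubmodule := by
    ext a
    simp only [LinearMap.mem_range, Subalgebra.mem_toSubmodule, Subalgebra.mem_center_iff]
    constructor
    · rintro ⟨c, rfl⟩ b
      apply φ.injective
      rw [map_mul, map_mul, hψ]
      ext i : 1
      exact ((Matrix.scalar_commute (c i) (fun _ => mul_comm _ _) (φ b i)).eq).symm
    · intro ha
      have : ∀ i, ∃ c, Matrix.scalar _ c = φ a i := by
        intro i
        refine Matrix.mem_range_scalar_iff_commute_single'.2 fun p q => ?_
        have := congrArg (fun y => φ y i) (ha (φ.symm (Pi.single i (Matrix.single p q 1))))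
        simpa [Commute, SemiconjBy] using this
      choose c hc using this
      refine ⟨c, φ.injective ?_⟩
      rw [hψ]
      exact funext hc
  rw [← hrange, LinearMap.finrank_range_of_inj hinj, Module.finrank_fintype_fun_eq_card]

/-- Over an algebraically closed field of characteristic zero, the simple modules of a finite
group are indexed by its conjugacy classes. -/
theorem exists_isSimpleReps_monoidAlgebra_group (k G : Type*) [Field k] [IsAlgClosed k]
    [CharZero k] [Group G] [Finite G] :
    ∃ L : Fin (Nat.card (ConjClasses G)) → Submodule (MonoidAlgebra k G) (MonoidAlgebra k G),
      IsSimpleReps L := by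
  classical
  have := Fintype.ofFinite G
  have : NeZero (Nat.card G : k) := ⟨by simp⟩
  have : IsSemisimpleRing (MonoidAlgebra k G) :=
    inferInstanceAs (IsSemisimpleModule (MonoidAlgebra k G) (MonoidAlgebra k G))
  have : FiniteDimensional k (MonoidAlgebra k G) :=
    Module.Finite.of_basis (MonoidAlgebra.basis G k)
  obtain ⟨n, d, hd, ⟨φ⟩⟩ :=
    IsSemisimpleRing.exists_algEquiv_pi_matrix_of_isAlgClosed k (MonoidAlgebra k G)
  have hn : Nat.card (ConjClasses G) = n := by
    have h := finrank_center_of_algEquiv_pi_matrix φ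
    have hinj : Function.Injective (classFunctionSum k G) := by
      intro c c' h
      ext q
      obtain ⟨g, rfl⟩ := ConjClasses.exists_rep q
      rw [← coeff_classFunctionSum c, h, coeff_classFunctionSum]
    rw [← range_classFunctionSum, LinearMap.finrank_range_of_inj hinj,
      Module.finrank_fintype_fun_eq_card, Fintype.card_fin] at h
    rw [Nat.card_eq_fintype_card, h]
  rw [hn]
  exact ⟨_, isSimpleReps_columnIdeal φ⟩

/-- In a finite monoid, a one-sided inverse relative to an idempotent is two-sided. -/
theorem mul_eq_of_mul_eq_idempotent {M : Type*} [Monoid M] [Finite M] {e p q : M}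
    (he : e * e = e) (hpq : p * q = e) (hq : e * q = q) (hp : p * e = p) : q * p = e := by
  let F : {z : M // e * z = z} → {z : M // e * z = z} :=
    fun z => ⟨q * z, by rw [← mul_assoc, hq]⟩
  have hF : Function.Injective F := by
    rintro ⟨z, hz⟩ ⟨w, hw⟩ h
    have h' : q * z = q * w := congrArg Subtype.val h
    apply Subtype.ext
    change z = w
    rw [← hz, ← hw, ← hpq, mul_assoc, mul_assoc, h']
  obtain ⟨⟨z, hz⟩, hFz⟩ := Finite.surjective_of_injective hF ⟨e, he⟩
  have hz' : q * z = e := congrArg Subtype.val hFz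
  have : z = p := by rw [← hz, ← hpq, mul_assoc, hz', hp]
  rwa [this] at hz'

/-- In a finite monoid, an element of `e M e` generating the same two-sided ideal as `e` is
invertible in `e M e`. -/
theorem exists_inverse_of_idempotent_eq_mul {M : Type*} [Monoid M] [Finite M] {e x a b : M}
    (he : e * e = e) (hxl : e * x = x) (hxr : x * e = x) (h : a * x * b = e) :
    ∃ y, e * y = y ∧ y * e = y ∧ x * y = e ∧ y * x = e := by
  have h1 : (e * a * e) * (x * (e * b * e)) = e := by
    calc (e * a * e) * (x * (e * b * e)) = e * (a * ((e * x) * e) * b) * e := by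
          simp only [mul_assoc]
      _ = e := by rw [hxl, hxr, h, he, he]
  have h2 : x * (e * b * e * (e * a * e)) = e := by
    rw [← mul_assoc]
    refine mul_eq_of_mul_eq_idempotent he h1 ?_ ?_
    · rw [← mul_assoc, hxl]
    · rw [mul_assoc, he]
  have hl : e * (e * b * e * (e * a * e)) = e * b * e * (e * a * e) := by
    simp only [← mul_assoc, he]
  have hr : (e * b * e * (e * a * e)) * e = e * b * e * (e * a * e) := by
    simp only [mul_assoc, he]
  exact ⟨_, hl, hr, h2, mul_eq_of_mul_eq_idempotent he h2 hl hxr⟩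

theorem exists_pow_mul_self_eq {M : Type*} [Monoid M] [Finite M] (x : M) :
    ∃ n, x ^ (n + 1) * x ^ (n + 1) = x ^ (n + 1) := by
  obtain ⟨i, j, hij, h⟩ := Finite.exists_ne_map_eq_of_infinite (fun n : ℕ => x ^ n)
  wlog hlt : i < j generalizing i j
  · exact this j i hij.symm h.symm (by omega)
  obtain ⟨p, rfl⟩ := Nat.exists_eq_add_of_lt hlt
  have hstep : ∀ q r, x ^ (i + r) = x ^ (i + r + q * (p + 1)) := by
    intro q
    induction q with
    | zero => simp
    | succ q ih =>
      intro r
      have h' : x ^ i = x ^ (i + p + 1) := h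
      rw [ih r, show i + r + (q + 1) * (p + 1) = (i + p + 1) + (r + q * (p + 1)) by ring,
        pow_add x (i + p + 1), ← h', ← pow_add, add_assoc]
  refine ⟨(i + 1) * p + i, ?_⟩
  have := hstep (i + 1) ((i + 1) * p + 1)
  rw [← pow_add, show (i + 1) * p + i + 1 = i + ((i + 1) * p + 1) by ring, this]
  congr 1
  ring

/-- A multiplicative embedding of a group `G` onto the group of units of `e M e`, `e = ρ 1`. -/
structure IsMaximalSubgroup {G M : Type*} [Group G] [Monoid M] (ρ : G →ₙ* M) : Prop where
  injective : Function.Injective ρ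
  exists_eq : ∀ x a b, a * (ρ 1 * x * ρ 1) * b = ρ 1 → ∃ g, ρ g = ρ 1 * x * ρ 1

section Corner

variable {k G M : Type*} [Field k] [Group G] [Monoid M] {ρ : G →ₙ* M}

theorem one_mul_mulHom (ρ : G →ₙ* M) (g : G) : ρ 1 * ρ g = ρ g := by rw [← map_mul, one_mul]

theorem mulHom_mul_one (ρ : G →ₙ* M) (g : G) : ρ g * ρ 1 = ρ g := by rw [← map_mul, mul_one]

open Classical in
/-- The element of `k G` given by the compression `e m e` if it is a unit, and `0` otherwise. -/
noncomputable def cornerValue (k : Type*) {G M : Type*} [Field k] [Group G] [Monoid M]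
    (ρ : G →ₙ* M) (m : M) : MonoidAlgebra k G :=
  if h : ∃ g, ρ g = ρ 1 * m * ρ 1 then MonoidAlgebra.single h.choose 1 else 0

theorem cornerValue_of_eq (hρ : IsMaximalSubgroup ρ) {m : M} {g : G} (h : ρ g = ρ 1 * m * ρ 1) :
    cornerValue k ρ m = MonoidAlgebra.single g 1 := by
  have hex : ∃ g, ρ g = ρ 1 * m * ρ 1 := ⟨g, h⟩
  rw [cornerValue, dif_pos hex, hρ.injective (hex.choose_spec.trans h.symm)]

theorem cornerValue_of_not {m : M} (h : ¬ ∃ g, ρ g = ρ 1 * m * ρ 1) : cornerValue k ρ m = 0 := by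
  rw [cornerValue, dif_neg h]

theorem cornerValue_mul (hρ : IsMaximalSubgroup ρ) (m m' : M) (g : G) :
    cornerValue k ρ (m * ρ g * m') =
      cornerValue k ρ m * MonoidAlgebra.single g 1 * cornerValue k ρ m' := by
  have key : ρ 1 * (m * ρ g * m') * ρ 1 = (ρ 1 * m * ρ 1) * ρ g * (ρ 1 * m' * ρ 1) := by
    conv_lhs => rw [← one_mul_mulHom ρ g, ← mulHom_mul_one ρ g]
    simp only [mul_assoc]
  by_cases h1 : ∃ g, ρ g = ρ 1 * m * ρ 1
  · by_cases h2 : ∃ g, ρ g = ρ 1 * m' * ρ 1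
    · obtain ⟨x, hx⟩ := h1
      obtain ⟨y, hy⟩ := h2
      rw [cornerValue_of_eq hρ hx, cornerValue_of_eq hρ hy, cornerValue_of_eq hρ (g := x * g * y)]
      · simp
      · rw [key, ← hx, ← hy, map_mul, map_mul]
    · rw [cornerValue_of_not h2, mul_zero, cornerValue_of_not]
      rintro ⟨z, hz⟩
      refine h2 (hρ.exists_eq m' (ρ z⁻¹ * (ρ 1 * m * ρ 1) * ρ g) 1 ?_)
      rw [mul_one, mul_assoc, mul_assoc, ← mul_assoc (ρ 1 * m * ρ 1), ← key, ← hz, ← map_mul,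
        inv_mul_cancel]
  · rw [cornerValue_of_not h1, zero_mul, zero_mul, cornerValue_of_not]
    rintro ⟨z, hz⟩
    refine h1 (hρ.exists_eq m 1 (ρ g * (ρ 1 * m' * ρ 1) * ρ z⁻¹) ?_)
    rw [one_mul, ← mul_assoc, ← mul_assoc, ← key, ← hz, ← map_mul, mul_inv_cancel]

/-- The linear extension of `cornerValue`. -/
noncomputable def cornerMap (k : Type*) {G M : Type*} [Field k] [Group G] [Monoid M]
    (ρ : G →ₙ* M) : MonoidAlgebra k M →ₗ[k] MonoidAlgebra k G :=
  (MonoidAlgebra.basis M k).constr k (cornerValue k ρ)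

theorem cornerMap_single (m : M) (r : k) :
    cornerMap k ρ (MonoidAlgebra.single m r) = r • cornerValue k ρ m := by
  have : MonoidAlgebra.single m r = r • MonoidAlgebra.basis M k m := by simp
  rw [this, map_smul, cornerMap, Module.Basis.constr_basis]

/-- The non-unital embedding of the group algebra into the monoid algebra. -/
noncomputable def cornerEmb (k : Type*) {G M : Type*} [Field k] [Group G] [Monoid M]
    (ρ : G →ₙ* M) : MonoidAlgebra k G →ₗ[k] MonoidAlgebra k M :=
  MonoidAlgebra.mapDomainLinearMap k k ρ

theorem cornerEmb_single (g : G) (r : k) :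
    cornerEmb k ρ (MonoidAlgebra.single g r) = MonoidAlgebra.single (ρ g) r := by
  simp [cornerEmb]

theorem cornerEmb_mul (s t : MonoidAlgebra k G) :
    cornerEmb k ρ (s * t) = cornerEmb k ρ s * cornerEmb k ρ t := by
  induction s using MonoidAlgebra.induction_linear with
  | zero => simp
  | add x y hx hy => rw [add_mul, map_add, hx, hy, map_add, add_mul]
  | single g r =>
    induction t using MonoidAlgebra.induction_linear with
    | zero => simp
    | add x y hx hy => rw [mul_add, map_add, hx, hy, map_add, mul_add]
    | single h r' => simp [cornerEmb_single]

theorem cornerMap_mul (hρ : IsMaximalSubgroup ρ) (x y : MonoidAlgebra k M)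
    (s : MonoidAlgebra k G) :
    cornerMap k ρ (x * cornerEmb k ρ s * y) = cornerMap k ρ x * s * cornerMap k ρ y := by
  induction x using MonoidAlgebra.induction_linear with
  | zero => simp
  | add x x' hx hx' => simp only [add_mul, map_add, hx, hx']
  | single m r =>
    induction y using MonoidAlgebra.induction_linear with
    | zero => simp
    | add x x' hx hx' => simp only [mul_add, map_add, hx, hx']
    | single m' r' =>
      induction s using MonoidAlgebra.induction_linear with
      | zero => simp
      | add x x' hx hx' => simp only [mul_add, add_mul, map_add, hx, hx']
      | single g c =>
        rw [cornerEmb_single, MonoidAlgebra.single_mul_single, MonoidAlgebra.single_mul_single,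
          cornerMap_single, cornerMap_single, cornerMap_single, cornerValue_mul hρ]
        have : MonoidAlgebra.single g c = c • MonoidAlgebra.single g (1 : k) := by simp
        rw [this]
        simp only [smul_mul_assoc, mul_smul_comm, smul_smul]
        congr 1
        ring

theorem cornerMap_one (hρ : IsMaximalSubgroup ρ) : cornerMap k ρ 1 = 1 := by
  rw [MonoidAlgebra.one_def, cornerMap_single, cornerValue_of_eq hρ (g := 1), one_smul,
    MonoidAlgebra.one_def]
  rw [mul_one, ← map_mul, one_mul]

theorem cornerMap_mul_emb (hρ : IsMaximalSubgroup ρ) (x : MonoidAlgebra k M)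
    (s : MonoidAlgebra k G) : cornerMap k ρ (x * cornerEmb k ρ s) = cornerMap k ρ x * s := by
  simpa [cornerMap_one hρ] using cornerMap_mul hρ x 1 s

theorem cornerMap_emb_mul (hρ : IsMaximalSubgroup ρ) (y : MonoidAlgebra k M)
    (s : MonoidAlgebra k G) : cornerMap k ρ (cornerEmb k ρ s * y) = s * cornerMap k ρ y := by
  simpa [cornerMap_one hρ] using cornerMap_mul hρ 1 y s

theorem cornerMap_emb (hρ : IsMaximalSubgroup ρ) (s : MonoidAlgebra k G) :
    cornerMap k ρ (cornerEmb k ρ s) = s := by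
  simpa [cornerMap_one hρ] using cornerMap_mul_emb hρ 1 s

/-- The largest left ideal of `k M` whose image under `cornerMap` lies in `L`. -/
noncomputable def cornerIdeal (ρ : G →ₙ* M)
    (L : Submodule (MonoidAlgebra k G) (MonoidAlgebra k G)) :
    Submodule (MonoidAlgebra k M) (MonoidAlgebra k M) where
  carrier := {a | ∀ b, cornerMap k ρ (b * a) ∈ L}
  zero_mem' b := by simp
  add_mem' := by
    intro x y hx hy b
    rw [mul_add, map_add]
    exact L.add_mem (hx b) (hy b)
  smul_mem' := by
    intro c x hx b
    rw [smul_eq_mul, ← mul_assoc]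
    exact hx _

variable {L L' : Submodule (MonoidAlgebra k G) (MonoidAlgebra k G)}

theorem mem_cornerIdeal {a : MonoidAlgebra k M} :
    a ∈ cornerIdeal ρ L ↔ ∀ b, cornerMap k ρ (b * a) ∈ L := Iff.rfl

theorem cornerEmb_mem_cornerIdeal (hρ : IsMaximalSubgroup ρ) {s : MonoidAlgebra k G} :
    cornerEmb k ρ s ∈ cornerIdeal ρ L ↔ s ∈ L := by
  refine ⟨fun h => ?_, fun h b => ?_⟩
  · simpa [cornerMap_emb hρ] using h 1
  · rw [cornerMap_mul_emb hρ]
    exact L.smul_mem _ h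

theorem isCoatom_cornerIdeal (hρ : IsMaximalSubgroup ρ) (hL : IsCoatom L) :
    IsCoatom (cornerIdeal ρ L) := by
  rw [isCoatom_iff_exists_mul_sub_one_mem] at hL ⊢
  refine ⟨fun h => hL.1 ?_, fun a ha => ?_⟩
  · simpa [cornerMap_one hρ] using h 1
  · simp only [mem_cornerIdeal, not_forall] at ha
    obtain ⟨b, hb⟩ := ha
    obtain ⟨s, hs⟩ := hL.2 _ hb
    refine ⟨cornerEmb k ρ s * b, fun x => ?_⟩
    have : cornerMap k ρ (x * (cornerEmb k ρ s * b * a - 1)) =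
        cornerMap k ρ x * (s * cornerMap k ρ (b * a) - 1) := by
      rw [mul_sub, mul_one, map_sub, mul_assoc, ← mul_assoc, cornerMap_mul hρ, mul_sub, mul_one,
        mul_assoc]
    rw [this]
    exact L.smul_mem _ hs

theorem exists_cornerIdeal_of_exists (hρ : IsMaximalSubgroup ρ)
    (h : ∃ s, s ∉ L' ∧ ∀ t, t * s ∈ L' ↔ t ∈ L) :
    ∃ s, s ∉ cornerIdeal ρ L' ∧ ∀ t, t * s ∈ cornerIdeal ρ L' ↔ t ∈ cornerIdeal ρ L := by
  obtain ⟨s, hs, h⟩ := h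
  refine ⟨cornerEmb k ρ s, fun h' => hs ((cornerEmb_mem_cornerIdeal hρ).1 h'), fun t => ?_⟩
  refine forall_congr' fun b => ?_
  rw [← mul_assoc, cornerMap_mul_emb hρ, h]

theorem cornerEmb_one : cornerEmb k ρ 1 = MonoidAlgebra.single (ρ 1) 1 := by
  rw [MonoidAlgebra.one_def, cornerEmb_single]

theorem exists_of_exists_cornerIdeal (hρ : IsMaximalSubgroup ρ) (hL : IsCoatom L)
    (h : ∃ s, s ∉ cornerIdeal ρ L' ∧ ∀ t, t * s ∈ cornerIdeal ρ L' ↔ t ∈ cornerIdeal ρ L) :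
    ∃ s, s ∉ L' ∧ ∀ t, t * s ∈ L' ↔ t ∈ L := by
  obtain ⟨a, -, h⟩ := h
  have key : ∀ t, t * cornerMap k ρ a ∈ L' ↔ t ∈ L := fun t => by
    rw [← cornerEmb_mem_cornerIdeal hρ (L := L), ← h, mem_cornerIdeal]
    refine ⟨fun ht b => ?_, fun ht => ?_⟩
    · rw [← mul_assoc, cornerMap_mul hρ, mul_assoc]
      exact L'.smul_mem _ ht
    · simpa [cornerMap_emb_mul hρ] using ht 1
  refine ⟨_, fun hm => ?_, key⟩
  exact ((isCoatom_iff_exists_mul_sub_one_mem L).1 hL).1 ((key 1).1 (by rwa [one_mul]))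

/-- Elements of `M` not generating `e` annihilate the quotient by `cornerIdeal ρ L`. -/
theorem single_mul_mem_cornerIdeal {x : M} (hx : ¬ ∃ a b, ρ 1 = a * x * b)
    (y : MonoidAlgebra k M) : MonoidAlgebra.single x 1 * y ∈ cornerIdeal ρ L := by
  intro b
  suffices cornerMap k ρ (b * (MonoidAlgebra.single x 1 * y)) = 0 by rw [this]; exact L.zero_mem
  induction b using MonoidAlgebra.induction_linear with
  | zero => simp
  | add u v hu hv => rw [add_mul, map_add, hu, hv, add_zero]
  | single m r =>
    induction y using MonoidAlgebra.induction_linear with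
    | zero => simp
    | add u v hu hv => rw [mul_add, mul_add, map_add, hu, hv, add_zero]
    | single m' r' =>
      rw [MonoidAlgebra.single_mul_single, MonoidAlgebra.single_mul_single, cornerMap_single,
        cornerValue_of_not, smul_zero]
      rintro ⟨g, hg⟩
      refine hx ⟨ρ g⁻¹ * (ρ 1 * m), m' * ρ 1, ?_⟩
      calc ρ 1 = ρ g⁻¹ * ρ g := by rw [← map_mul, inv_mul_cancel]
        _ = _ := by rw [hg]; simp only [mul_assoc]

/-- If the quotients attached to two maximal subgroups are isomorphic, each idempotent lies in
the two-sided ideal generated by the other. -/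
theorem exists_eq_mul_of_exists_cornerIdeal {G' : Type*} [Group G'] {ρ' : G' →ₙ* M}
    {L' : Submodule (MonoidAlgebra k G') (MonoidAlgebra k G')}
    (hρ : IsMaximalSubgroup ρ) (hL : IsCoatom L)
    (h : ∃ s, s ∉ cornerIdeal ρ' L' ∧ ∀ t, t * s ∈ cornerIdeal ρ' L' ↔ t ∈ cornerIdeal ρ L) :
    ∃ a b, ρ' 1 = a * ρ 1 * b := by
  by_contra hcon
  obtain ⟨s, -, h⟩ := h
  have h1 := (h _).1 (single_mul_mem_cornerIdeal (L := L') hcon s)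
  rw [← cornerEmb_one, cornerEmb_mem_cornerIdeal hρ] at h1
  exact ((isCoatom_iff_exists_mul_sub_one_mem L).1 hL).1 h1

end Corner

section Apex

variable {k M V : Type*} [Field k] [Monoid M] [AddCommGroup V] [Module (MonoidAlgebra k M) V]

theorem single_eq_mul_single_one (m : M) (r : k) :
    MonoidAlgebra.single m r = MonoidAlgebra.single 1 r * MonoidAlgebra.single m 1 := by simp

theorem single_one_mul_comm (m : M) (r : k) :
    MonoidAlgebra.single m (1 : k) * MonoidAlgebra.single 1 r =
      MonoidAlgebra.single 1 r * MonoidAlgebra.single m 1 := by simp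

theorem single_mul_smul (m m' : M) (v : V) :
    (MonoidAlgebra.single (m * m') (1 : k)) • v =
      MonoidAlgebra.single m (1 : k) • MonoidAlgebra.single m' (1 : k) • v := by
  rw [← mul_smul, MonoidAlgebra.single_mul_single, one_mul]

/-- On a simple module, two elements acting nontrivially have a nontrivial product through some
monoid element. -/
theorem exists_single_mul_mul_smul_ne_zero [IsSimpleModule (MonoidAlgebra k M) V] {x y : M}
    (hx : ∃ v : V, MonoidAlgebra.single x (1 : k) • v ≠ 0)
    (hy : ∃ v : V, MonoidAlgebra.single y (1 : k) • v ≠ 0) :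
    ∃ (b : M) (v : V), MonoidAlgebra.single (x * b * y) (1 : k) • v ≠ 0 := by
  obtain ⟨v, hv⟩ := hx
  obtain ⟨w, hw⟩ := hy
  obtain ⟨a, ha⟩ := IsSimpleModule.toSpanSingleton_surjective (MonoidAlgebra k M) hw v
  by_contra! hcon
  refine hv ?_
  rw [← ha, LinearMap.toSpanSingleton_apply]
  clear ha
  induction a using MonoidAlgebra.induction_linear with
  | zero => simp
  | add a a' iha iha' => rw [add_smul, smul_add, iha, iha', add_zero]
  | single m r =>
    rw [single_eq_mul_single_one m r, mul_smul, ← mul_smul, single_one_mul_comm, mul_smul,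
      ← single_mul_smul, ← single_mul_smul, hcon, smul_zero]

/-- A simple module over the algebra of a finite monoid has an apex, witnessed by an
idempotent. -/
theorem exists_idempotent_apex [Finite M] [IsSimpleModule (MonoidAlgebra k M) V] :
    ∃ f : M, f * f = f ∧ (∃ v : V, MonoidAlgebra.single f (1 : k) • v ≠ 0) ∧
      ∀ x : M, (∃ v : V, MonoidAlgebra.single x (1 : k) • v ≠ 0) → ∃ a b, f = a * x * b := by
  have : Nontrivial V := IsSimpleModule.nontrivial (MonoidAlgebra k M) V
  let J : M → Set M := fun m => {y | ∃ a b, y = a * m * b}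
  let S : Set M := {m | ∃ v : V, MonoidAlgebra.single m (1 : k) • v ≠ 0}
  have hS : S.Nonempty := by
    obtain ⟨v, hv⟩ := exists_ne (0 : V)
    exact ⟨1, v, by rwa [← MonoidAlgebra.one_def, one_smul]⟩
  obtain ⟨m, hm, hmin⟩ := Set.exists_min_image S (fun m => (J m).ncard) S.toFinite hS
  have key : ∀ x ∈ S, ∃ b c d, m = c * (m * b * x) * d := by
    intro x hx
    obtain ⟨b, v, hv⟩ := exists_single_mul_mul_smul_ne_zero hm hx
    have hle : J (m * b * x) ⊆ J m := by
      rintro _ ⟨c, d, rfl⟩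
      exact ⟨c, b * x * d, by simp only [mul_assoc]⟩
    have heq := Set.eq_of_subset_of_ncard_le hle (hmin _ ⟨v, hv⟩) (Set.toFinite _)
    have hmem : m ∈ J m := ⟨1, 1, by simp⟩
    rw [← heq] at hmem
    obtain ⟨c, d, h⟩ := hmem
    exact ⟨b, c, d, h⟩
  obtain ⟨b, c, d, hbcd⟩ := key m hm
  have hpow : ∀ n, m = (c * m * b) ^ n * m * d ^ n := by
    intro n
    induction n with
    | zero => simp
    | succ n ih =>
      calc m = (c * m * b) ^ n * (c * (m * b * m) * d) * d ^ n := by rw [← hbcd, ← ih]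
        _ = _ := by rw [pow_succ, pow_succ']; simp only [mul_assoc]
  obtain ⟨n, hn⟩ := exists_pow_mul_self_eq (c * m * b)
  have hfm : (c * m * b) ^ (n + 1) = (c * m * b) ^ n * c * m * b := by
    rw [pow_succ]; simp only [mul_assoc]
  refine ⟨(c * m * b) ^ (n + 1), hn, ?_, fun x hx => ?_⟩
  · by_contra! hcon
    obtain ⟨v, hv⟩ := hm
    refine hv ?_
    rw [hpow (n + 1), mul_assoc, single_mul_smul, hcon]
  · obtain ⟨b', c', d', h⟩ := key x hx
    refine ⟨(c * m * b) ^ n * c * (c' * m * b'), d' * b, ?_⟩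
    rw [hfm]
    conv_lhs => rw [mul_assoc _ m b]; arg 2; arg 1; rw [h]
    simp only [mul_assoc]

/-- A simple module with apex the idempotent of a maximal subgroup comes from a simple module
of this subgroup. -/
theorem exists_linearEquiv_quotient_cornerIdeal {G : Type*} [Group G]
    [IsSimpleModule (MonoidAlgebra k M) V] {ρ : G →ₙ* M} (hρ : IsMaximalSubgroup ρ)
    (hne : ∃ v : V, MonoidAlgebra.single (ρ 1) (1 : k) • v ≠ 0)
    (hapex : ∀ x : M, (∃ v : V, MonoidAlgebra.single x (1 : k) • v ≠ 0) →
      ∃ a b, ρ 1 = a * x * b) :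
    ∃ L : Submodule (MonoidAlgebra k G) (MonoidAlgebra k G), IsCoatom L ∧
      Nonempty (V ≃ₗ[MonoidAlgebra k M] MonoidAlgebra k M ⧸ cornerIdeal ρ L) := by
  obtain ⟨v₀, hv₀⟩ := hne
  set e : MonoidAlgebra k M := MonoidAlgebra.single (ρ 1) 1 with he
  have hee : e * e = e := by simp [he, ← map_mul]
  set v := e • v₀ with hv
  have hev : e • v = v := by rw [hv, ← mul_smul, hee]
  have hes : ∀ s, e * cornerEmb k ρ s = cornerEmb k ρ s := fun s => by
    rw [he, ← cornerEmb_one, ← cornerEmb_mul, one_mul]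
  have key : ∀ (a : MonoidAlgebra k M) (w : V),
      (e * a * e) • w = cornerEmb k ρ (cornerMap k ρ a) • w := by
    intro a w
    induction a using MonoidAlgebra.induction_linear with
    | zero => simp
    | add x y hx hy => simp only [mul_add, add_mul, map_add, add_smul, hx, hy]
    | single m r =>
      have h1 : e * MonoidAlgebra.single m r * e =
          MonoidAlgebra.single 1 r * MonoidAlgebra.single (ρ 1 * m * ρ 1) 1 := by simp [he]
      rw [h1, mul_smul, cornerMap_single]
      by_cases h : ∃ g, ρ g = ρ 1 * m * ρ 1
      · obtain ⟨g, hg⟩ := h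
        rw [cornerValue_of_eq hρ hg, map_smul, cornerEmb_single, hg, ← mul_smul]
        simp
      · rw [cornerValue_of_not h, smul_zero, map_zero, zero_smul]
        by_cases h0 : MonoidAlgebra.single (ρ 1 * m * ρ 1) (1 : k) • w = 0
        · rw [h0, smul_zero]
        · obtain ⟨a, b, hab⟩ := hapex _ ⟨w, h0⟩
          exact absurd (hρ.exists_eq m a b hab.symm) h
  let L : Submodule (MonoidAlgebra k G) (MonoidAlgebra k G) :=
    { carrier := {s | cornerEmb k ρ s • v = 0}
      zero_mem' := by simp
      add_mem' := by
        intro s t (hs : _ = _) (ht : _ = _)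
        change _ = _
        rw [map_add, add_smul, hs, ht, add_zero]
      smul_mem' := by
        intro c s (hs : _ = _)
        change _ = _
        rw [smul_eq_mul, cornerEmb_mul, mul_smul, hs, smul_zero] }
  have hmem : ∀ s, s ∈ L ↔ cornerEmb k ρ s • v = 0 := fun s => Iff.rfl
  have htrans : ∀ w w' : V, w ≠ 0 → ∃ b : MonoidAlgebra k M, b • w = w' :=
    fun w w' hw => IsSimpleModule.toSpanSingleton_surjective (MonoidAlgebra k M) hw w'
  refine ⟨L, (isCoatom_iff_exists_mul_sub_one_mem L).2 ⟨?_, fun s hs => ?_⟩,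
    nonempty_linearEquiv_quotient_of_annihilator hv₀ _ fun a => ?_⟩
  · rw [hmem, cornerEmb_one, hev]
    exact hv₀
  · obtain ⟨b, hb⟩ := htrans _ v hs
    refine ⟨cornerMap k ρ b, ?_⟩
    rw [hmem, map_sub, sub_smul, cornerEmb_one, cornerEmb_mul, mul_smul, ← key, ← mul_smul,
      mul_assoc, hes, mul_smul, mul_smul, hb, sub_self]
  · have hba : ∀ b, cornerMap k ρ (b * a) ∈ L ↔ (e * b) • a • v = 0 := fun b => by
      rw [hmem, ← key, mul_smul, hev, ← mul_assoc, mul_smul]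
    rw [mem_cornerIdeal]
    refine ⟨fun h b => ?_, fun h => ?_⟩
    · rw [hba, h, smul_zero]
    · by_contra hav
      obtain ⟨b, hb⟩ := htrans _ v hav
      refine hv₀ ?_
      calc v = (e * b) • a • v := by rw [mul_smul, hb, hev]
        _ = 0 := (hba b).1 (h b)

/-- **Clifford–Munn–Ponizovskii**: the simple modules over the algebra of a finite monoid are
parametrized by the simple modules of its maximal subgroups, one for each regular class. -/
theorem clifford_munn_ponizovskii [Finite M] {ι : Type*} {κ : ι → Type*} {G : ι → Type*}
    [∀ i, Group (G i)] (ρ : ∀ i, G i →ₙ* M) (hρ : ∀ i, IsMaximalSubgroup (ρ i))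
    (hinj : ∀ i j, (∃ a b, ρ i 1 = a * ρ j 1 * b) → (∃ a b, ρ j 1 = a * ρ i 1 * b) → i = j)
    (hsurj : ∀ f : M, f * f = f →
      ∃ i, (∃ a b, f = a * ρ i 1 * b) ∧ ∃ a b, ρ i 1 = a * f * b)
    (L : ∀ i, κ i → Submodule (MonoidAlgebra k (G i)) (MonoidAlgebra k (G i)))
    (hL : ∀ i, IsSimpleReps (L i)) :
    IsSimpleReps fun p : Σ i, κ i => cornerIdeal (ρ p.1) (L p.1 p.2) where
  isCoatom p := isCoatom_cornerIdeal (hρ p.1) ((hL p.1).isCoatom p.2)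
  injective := by
    rintro ⟨i, p⟩ ⟨j, q⟩ s hs h
    have hp := isCoatom_cornerIdeal (hρ i) ((hL i).isCoatom p)
    have hq := isCoatom_cornerIdeal (hρ j) ((hL j).isCoatom q)
    have h₁ := exists_eq_mul_of_exists_cornerIdeal (hρ i) ((hL i).isCoatom p) ⟨s, hs, h⟩
    obtain ⟨e⟩ := (nonempty_quotient_linearEquiv_iff hp hq).2 ⟨s, hs, h⟩
    have h₂ := exists_eq_mul_of_exists_cornerIdeal (hρ j) ((hL j).isCoatom q)
      ((nonempty_quotient_linearEquiv_iff hq hp).1 ⟨e.symm⟩)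
    obtain rfl := hinj i j h₂ h₁
    obtain ⟨t, ht, h'⟩ :=
      exists_of_exists_cornerIdeal (hρ i) ((hL i).isCoatom p) ⟨s, hs, h⟩
    rw [(hL i).injective p q t ht h']
  exists_rep := by
    intro I hI
    have : IsSimpleModule (MonoidAlgebra k M) (MonoidAlgebra k M ⧸ I) :=
      isSimpleModule_iff_isCoatom.2 hI
    obtain ⟨f, hff, ⟨v, hv⟩, hf⟩ :=
      exists_idempotent_apex (k := k) (M := M) (V := MonoidAlgebra k M ⧸ I)
    obtain ⟨i, ⟨a, b, hab⟩, c, d, hcd⟩ := hsurj f hff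
    obtain ⟨L', hL', ⟨e⟩⟩ := exists_linearEquiv_quotient_cornerIdeal
      (V := MonoidAlgebra k M ⧸ I) (hρ i)
      ⟨MonoidAlgebra.single b (1 : k) • v, fun h0 => hv (by
        rw [hab, single_mul_smul, single_mul_smul, h0, smul_zero])⟩
      (fun x hx => by
        obtain ⟨a', b', h⟩ := hf x hx
        exact ⟨c * a', b' * d, by rw [hcd, h]; simp only [mul_assoc]⟩)
    obtain ⟨p, s, hs⟩ := (hL i).exists_rep L' hL'
    have hp := isCoatom_cornerIdeal (hρ i) ((hL i).isCoatom p)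
    have hc := isCoatom_cornerIdeal (hρ i) hL'
    obtain ⟨e'⟩ := (nonempty_quotient_linearEquiv_iff hp hc).2
      (exists_cornerIdeal_of_exists (hρ i) ⟨s, hs⟩)
    exact ⟨⟨i, p⟩, (nonempty_quotient_linearEquiv_iff hp hI).1 ⟨e'.trans e.symm⟩⟩

end Apex

section Relations

variable {E F X : Type} {R : Set (E × E)} {S : Set (F × F)}

theorem conjRel_eq_iff {σ : Equiv.Perm E} {T : Set (E × E)} :
    conjRel σ R = T ↔ ∀ a b, (a, b) ∈ R ↔ (σ a, σ b) ∈ T := by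
  constructor
  · rintro rfl a b
    refine ⟨fun h => ⟨(a, b), h, rfl⟩, ?_⟩
    rintro ⟨⟨c, d⟩, h, heq⟩
    simp only [Prod.mk.injEq, EmbeddingLike.apply_eq_iff_eq] at heq
    rwa [heq.1, heq.2]
  · intro h
    ext ⟨x, y⟩
    constructor
    · rintro ⟨⟨a, b⟩, hab, heq⟩
      rw [heq]
      exact (h a b).1 hab
    · intro hxy
      refine ⟨(σ.symm x, σ.symm y), (h _ _).2 (by simpa using hxy), by simp⟩

theorem mem_autRel_iff {σ : Equiv.Perm E} :
    σ ∈ autRel E R ↔ ∀ a b, (a, b) ∈ R ↔ (σ a, σ b) ∈ R := conjRel_eq_iff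

/-- The relation on `X` obtained by transporting a relation along an embedding `ι : E ↪ X`. -/
def pushRel (ι : E ↪ X) (R : Set (E × E)) : Set (X × X) :=
  {p | ∃ a b, (a, b) ∈ R ∧ p = (ι a, ι b)}

theorem mk_mem_pushRel {ι : E ↪ X} {a b : E} : (ι a, ι b) ∈ pushRel ι R ↔ (a, b) ∈ R := by
  constructor
  · rintro ⟨c, d, h, heq⟩
    simp only [Prod.mk.injEq, EmbeddingLike.apply_eq_iff_eq] at heq
    rwa [heq.1, heq.2]
  · intro h
    exact ⟨a, b, h, rfl⟩

theorem pushRel_mul_pushRel {T : Set (E × E)} (ι : E ↪ X) :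
    pushRel ι R * pushRel ι T = pushRel ι (R * T) := by
  ext ⟨x, y⟩
  constructor
  · rintro ⟨z, ⟨a, b, h, heq⟩, c, d, h', heq'⟩
    simp only [Prod.mk.injEq] at heq heq'
    obtain rfl := ι.injective (heq.2.symm.trans heq'.1)
    exact ⟨a, d, ⟨b, h, h'⟩, by rw [heq.1, heq'.2]⟩
  · rintro ⟨a, d, ⟨b, h, h'⟩, heq⟩
    rw [heq]
    exact ⟨ι b, ⟨a, b, h, rfl⟩, b, d, h', rfl⟩

theorem pushRel_injective (ι : E ↪ X) : Function.Injective (pushRel ι) := by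
  intro T U h
  ext ⟨a, b⟩
  rw [← mk_mem_pushRel (ι := ι), h, mk_mem_pushRel]

theorem IsOrderRel.mul_self (hR : IsOrderRel R) : R * R = R := by
  ext ⟨a, b⟩
  exact ⟨fun ⟨c, h, h'⟩ => hR.2.2 _ _ _ h h', fun h => ⟨a, hR.1 a, h⟩⟩

/-- The relations `Δ_σ R`, for `σ` an automorphism of the poset `(E, R)`, transported along an
embedding of `E` into `X`. -/
def autHom (hR : IsOrderRel R) (ι : E ↪ X) : autRel E R →ₙ* Set (X × X) where
  toFun σ := pushRel ι {p | ((σ⁻¹ : Equiv.Perm E) p.1, p.2) ∈ R}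
  map_mul' σ τ := by
    rw [pushRel_mul_pushRel]
    congr 1
    ext ⟨a, b⟩
    have hτ := mem_autRel_iff.1 (τ⁻¹).2
    simp only [Subgroup.coe_inv] at hτ
    change ((((σ : Equiv.Perm E) * τ)⁻¹ : Equiv.Perm E) a, b) ∈ R ↔
      ∃ c, ((σ⁻¹ : Equiv.Perm E) a, c) ∈ R ∧ ((τ⁻¹ : Equiv.Perm E) c, b) ∈ R
    rw [mul_inv_rev, Equiv.Perm.mul_apply]
    constructor
    · exact fun h => ⟨(σ⁻¹ : Equiv.Perm E) a, hR.1 _, h⟩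
    · rintro ⟨c, h, h'⟩
      exact hR.2.2 _ _ _ ((hτ _ _).1 h) h'

theorem autHom_apply (hR : IsOrderRel R) (ι : E ↪ X) (σ : autRel E R) :
    autHom hR ι σ = pushRel ι {p | ((σ⁻¹ : Equiv.Perm E) p.1, p.2) ∈ R} := rfl

theorem autHom_one (hR : IsOrderRel R) (ι : E ↪ X) : autHom hR ι 1 = pushRel ι R := by
  rw [autHom_apply]
  simp

theorem autHom_injective (hR : IsOrderRel R) (ι : E ↪ X) : Function.Injective (autHom hR ι) := by
  intro σ τ h
  have h' : ∀ a b, ((σ⁻¹ : Equiv.Perm E) a, b) ∈ R ↔ ((τ⁻¹ : Equiv.Perm E) a, b) ∈ R := fun a b =>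
    Set.ext_iff.1 (pushRel_injective ι h) (a, b)
  have : (σ⁻¹ : Equiv.Perm E) = (τ⁻¹ : Equiv.Perm E) := Equiv.ext fun a =>
    hR.2.1 _ _ ((h' a _).2 (hR.1 _)) ((h' a _).1 (hR.1 _))
  exact Subtype.ext (inv_injective this)

/-- Mutually inverse relations between two posets come from an isomorphism of posets. -/
theorem exists_equiv_of_mul_eq_pushRel (hR : IsOrderRel R) (hS : IsOrderRel S) (ι : E ↪ X)
    (κ : F ↪ X) {Q Q' : Set (X × X)} (hQ : pushRel ι R * Q = Q) (hQ₂ : Q * pushRel κ S = Q)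
    (h : Q * Q' = pushRel ι R) (h' : Q' * Q = pushRel κ S) :
    ∃ σ : E ≃ F, (∀ a b, (a, b) ∈ R ↔ (σ a, σ b) ∈ S) ∧
      ∀ x y, (x, y) ∈ Q ↔ ∃ a b, (σ a, b) ∈ S ∧ x = ι a ∧ y = κ b := by
  have hfst : ∀ {x y}, (x, y) ∈ Q → ∃ a, x = ι a := by
    intro x y hxy
    rw [← hQ] at hxy
    obtain ⟨z, ⟨a, b, -, heq⟩, -⟩ := hxy
    exact ⟨a, congrArg Prod.fst heq⟩
  have hsnd : ∀ {x y}, (x, y) ∈ Q → ∃ b, y = κ b := by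
    intro x y hxy
    rw [← hQ₂] at hxy
    obtain ⟨z, -, a, b, -, heq⟩ := hxy
    exact ⟨b, congrArg Prod.snd heq⟩
  have hf : ∀ a, ∃ b, (ι a, κ b) ∈ Q ∧ (κ b, ι a) ∈ Q' := by
    intro a
    have ha := mk_mem_pushRel (ι := ι).2 (hR.1 a)
    rw [← h] at ha
    obtain ⟨y, hy, hy'⟩ := ha
    obtain ⟨b, rfl⟩ := hsnd hy
    exact ⟨b, hy, hy'⟩
  have hg : ∀ b, ∃ a, (ι a, κ b) ∈ Q ∧ (κ b, ι a) ∈ Q' := by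
    intro b
    have hb := mk_mem_pushRel (ι := κ).2 (hS.1 b)
    rw [← h'] at hb
    obtain ⟨x, hx', hx⟩ := hb
    obtain ⟨a, rfl⟩ := hfst hx
    exact ⟨a, hx, hx'⟩
  choose f hf hf' using hf
  choose g hg hg' using hg
  have hSmem : ∀ {a b b'}, (κ b, ι a) ∈ Q' → (ι a, κ b') ∈ Q → (b, b') ∈ S := by
    intro a b b' h₁ h₂
    rw [← mk_mem_pushRel (ι := κ), ← h']
    exact ⟨_, h₁, h₂⟩
  have hRmem : ∀ {a a' b}, (ι a, κ b) ∈ Q → (κ b, ι a') ∈ Q' → (a, a') ∈ R := by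
    intro a a' b h₁ h₂
    rw [← mk_mem_pushRel (ι := ι), ← h]
    exact ⟨_, h₁, h₂⟩
  let σ : E ≃ F :=
    { toFun := f
      invFun := g
      left_inv := fun a => hR.2.1 _ _ (hRmem (hg _) (hf' _)) (hRmem (hf _) (hg' _))
      right_inv := fun b => hS.2.1 _ _ (hSmem (hf' _) (hg _)) (hSmem (hg' _) (hf _)) }
  refine ⟨σ, fun a b => ⟨fun hab => ?_, fun hab => ?_⟩, fun x y => ⟨fun hxy => ?_, ?_⟩⟩
  · refine hSmem (hf' a) ?_
    rw [← hQ]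
    exact ⟨_, mk_mem_pushRel.2 hab, hf b⟩
  · refine hRmem (b := f b) ?_ (hf' b)
    rw [← hQ₂]
    exact ⟨_, hf a, mk_mem_pushRel.2 hab⟩
  · obtain ⟨a, rfl⟩ := hfst hxy
    obtain ⟨b, rfl⟩ := hsnd hxy
    exact ⟨a, b, hSmem (hf' a) hxy, rfl, rfl⟩
  · rintro ⟨a, b, hab, rfl, rfl⟩
    rw [← hQ₂]
    exact ⟨_, hf a, mk_mem_pushRel.2 hab⟩

theorem isMaximalSubgroup_autHom [Finite X] (hR : IsOrderRel R) (ι : E ↪ X) :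
    IsMaximalSubgroup (autHom hR ι) where
  injective := autHom_injective hR ι
  exists_eq := by
    intro x a b hab
    rw [autHom_one] at hab ⊢
    set e := pushRel ι R with he
    have hee : e * e = e := by rw [he, pushRel_mul_pushRel, hR.mul_self]
    have hl : e * (e * x * e) = e * x * e := by simp only [← mul_assoc, hee]
    have hr : e * x * e * e = e * x * e := by rw [mul_assoc, hee]
    obtain ⟨y, -, -, hxy, hyx⟩ := exists_inverse_of_idempotent_eq_mul hee hl hr hab
    obtain ⟨σ, hσ, hQ⟩ := exists_equiv_of_mul_eq_pushRel hR hR ι ι hl hr hxy hyx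
    refine ⟨(⟨σ, mem_autRel_iff.2 hσ⟩ : autRel E R)⁻¹, ?_⟩
    ext ⟨u, v⟩
    rw [hQ, autHom_apply]
    simp [pushRel]

/-- Isomorphic posets give idempotents generating the same two-sided ideal. -/
theorem exists_pushRel_eq_mul (ι : E ↪ X) (κ : F ↪ X) (σ : E ≃ F)
    (hσ : ∀ a b, (a, b) ∈ R ↔ (σ a, σ b) ∈ S) :
    ∃ t t', pushRel ι R = t * pushRel κ S * t' := by
  refine ⟨{p | ∃ a, p = (ι a, κ (σ a))}, {p | ∃ a, p = (κ (σ a), ι a)}, ?_⟩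
  ext ⟨x, y⟩
  constructor
  · rintro ⟨a, b, hab, heq⟩
    rw [heq]
    exact ⟨κ (σ b), ⟨κ (σ a), ⟨a, rfl⟩, mk_mem_pushRel.2 ((hσ a b).1 hab)⟩, b, rfl⟩
  · rintro ⟨w, ⟨z, ⟨a, ha⟩, h⟩, b, hb⟩
    simp only [Prod.mk.injEq] at ha hb
    obtain ⟨rfl, rfl⟩ := ha
    obtain ⟨rfl, rfl⟩ := hb
    exact mk_mem_pushRel.2 ((hσ a b).2 (mk_mem_pushRel.1 h))

/-- Posets whose idempotents generate the same two-sided ideal are isomorphic. -/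
theorem exists_equiv_of_pushRel_eq_mul [Finite X] (hR : IsOrderRel R) (hS : IsOrderRel S)
    (ι : E ↪ X) (κ : F ↪ X) (h₁ : ∃ a b, pushRel ι R = a * pushRel κ S * b)
    (h₂ : ∃ a b, pushRel κ S = a * pushRel ι R * b) :
    ∃ σ : E ≃ F, ∀ a b, (a, b) ∈ R ↔ (σ a, σ b) ∈ S := by
  obtain ⟨a, b, hab⟩ := h₁
  obtain ⟨c, d, hcd⟩ := h₂
  have hee : pushRel ι R * pushRel ι R = pushRel ι R := by rw [pushRel_mul_pushRel, hR.mul_self]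
  have hff : pushRel κ S * pushRel κ S = pushRel κ S := by rw [pushRel_mul_pushRel, hS.mul_self]
  set e := pushRel ι R
  set f := pushRel κ S
  have hQl : e * (e * a * f) = e * a * f := by simp only [← mul_assoc, hee]
  have hQr : e * a * f * f = e * a * f := by rw [mul_assoc, hff]
  have hQl' : f * (f * b * e) = f * b * e := by simp only [← mul_assoc, hff]
  have hQQ : (e * a * f) * (f * b * e) = e := by
    calc (e * a * f) * (f * b * e) = e * (a * (f * f) * b) * e := by simp only [mul_assoc]
      _ = e := by rw [hff, ← hab, hee, hee]
  generalize e * a * f = Q at *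
  generalize f * b * e = Q' at *
  have hqq : (Q' * Q) * (Q' * Q) = Q' * Q := by
    rw [mul_assoc, ← mul_assoc Q, hQQ, hQl]
  have hl : f * (Q' * Q) = Q' * Q := by rw [← mul_assoc, hQl']
  have hr : (Q' * Q) * f = Q' * Q := by rw [mul_assoc, hQr]
  have hfac : (c * Q) * (Q' * Q) * (Q' * d) = f := by
    calc (c * Q) * (Q' * Q) * (Q' * d) = c * ((Q * Q') * (Q * Q')) * d := by
          simp only [mul_assoc]
      _ = f := by rw [hQQ, hee, ← hcd]
  obtain ⟨y, -, -, hy, -⟩ := exists_inverse_of_idempotent_eq_mul hff hl hr hfac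
  have hq : Q' * Q = f := by
    rw [← hr]
    conv_lhs => rw [← hy, ← mul_assoc, hqq, hy]
  obtain ⟨σ, hσ, -⟩ := exists_equiv_of_mul_eq_pushRel hR hS ι κ hQl hQr hQQ hq
  exact ⟨σ, hσ⟩

/-- An idempotent relation on a finite set is interpolated by its reflexive points. -/
theorem exists_refl_of_mem_of_mul_self_eq [Finite X] {f : Set (X × X)} (hf : f * f = f) {z x : X}
    (h : (z, x) ∈ f) : ∃ y, (y, y) ∈ f ∧ (z, y) ∈ f ∧ (y, x) ∈ f := by
  have htrans : ∀ {u v w}, (u, v) ∈ f → (v, w) ∈ f → (u, w) ∈ f := by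
    intro u v w h₁ h₂
    rw [← hf]
    exact ⟨v, h₁, h₂⟩
  have hmid : ∀ {u w}, (u, w) ∈ f → ∃ v, (u, v) ∈ f ∧ (v, w) ∈ f := by
    intro u w h
    rw [← hf] at h
    exact h
  let A : Set X := {y | (z, y) ∈ f ∧ (y, x) ∈ f}
  obtain ⟨y, hy, hmin⟩ :=
    Set.exists_min_image A (fun y => {w | (w, y) ∈ f}.ncard) A.toFinite (hmid h)
  obtain ⟨v, hzv, hvy⟩ := hmid hy.1
  have hle : {w | (w, v) ∈ f} ⊆ {w | (w, y) ∈ f} := fun w hw => htrans hw hvy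
  have hv : v ∈ A := ⟨hzv, htrans hvy hy.2⟩
  have heq := Set.eq_of_subset_of_ncard_le hle (hmin v hv) (Set.toFinite _)
  have hmem : v ∈ {w | (w, y) ∈ f} := hvy
  rw [← heq] at hmem
  exact ⟨v, hmem, hv⟩

/-- An idempotent relation on a finite set generates the same two-sided ideal as a partial
order on a subset. -/
theorem exists_pushRel_of_mul_self_eq [Finite X] {f : Set (X × X)} (hf : f * f = f) :
    ∃ (E : Type) (ι : E ↪ X) (R : Set (E × E)), IsOrderRel R ∧
      (∃ a b, f = a * pushRel ι R * b) ∧ ∃ a b, pushRel ι R = a * f * b := by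
  have htrans : ∀ {u v w}, (u, v) ∈ f → (v, w) ∈ f → (u, w) ∈ f := by
    intro u v w h₁ h₂
    rw [← hf]
    exact ⟨v, h₁, h₂⟩
  let r : Setoid {x : X // (x, x) ∈ f} :=
    { r := fun x y => (x.1, y.1) ∈ f ∧ (y.1, x.1) ∈ f
      iseqv :=
        { refl := fun x => ⟨x.2, x.2⟩
          symm := fun h => ⟨h.2, h.1⟩
          trans := fun h h' => ⟨htrans h.1 h'.1, htrans h'.2 h.2⟩ } }
  let ι : Quotient r ↪ X := ⟨fun q => q.out.1, fun q q' h => by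
    rw [← Quotient.out_eq q, ← Quotient.out_eq q', Subtype.ext h]⟩
  have hι : ∀ q, (ι q, ι q) ∈ f := fun q => q.out.2
  have hrep : ∀ x, (x, x) ∈ f → ∃ q, (x, ι q) ∈ f ∧ (ι q, x) ∈ f := fun x hx =>
    ⟨Quotient.mk r ⟨x, hx⟩, (Quotient.mk_out (s := r) ⟨x, hx⟩).symm⟩
  have hsub : ∀ {x y}, (x, y) ∈ pushRel ι {p | (ι p.1, ι p.2) ∈ f} → (x, y) ∈ f := by
    rintro x y ⟨a, b, h, heq⟩
    rw [heq]
    exact h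
  refine ⟨Quotient r, ι, {p | (ι p.1, ι p.2) ∈ f}, ⟨hι, fun p q h h' => ?_,
    fun _ _ _ => htrans⟩, ⟨f, f, ?_⟩, pushRel ι {p | (ι p.1, ι p.2) ∈ f},
      pushRel ι {p | (ι p.1, ι p.2) ∈ f}, ?_⟩
  · rw [← Quotient.out_eq p, ← Quotient.out_eq q]
    exact Quotient.sound ⟨h, h'⟩
  · ext ⟨z, x⟩
    constructor
    · intro h
      obtain ⟨y, hy, hzy, hyx⟩ := exists_refl_of_mem_of_mul_self_eq hf h
      obtain ⟨q, hq, hq'⟩ := hrep y hy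
      exact ⟨ι q, ⟨ι q, htrans hzy hq, mk_mem_pushRel.2 (hι q)⟩, htrans hq' hyx⟩
    · rintro ⟨v, ⟨u, h₁, h₂⟩, h₃⟩
      exact htrans (htrans h₁ (hsub h₂)) h₃
  · ext ⟨x, y⟩
    constructor
    · rintro ⟨a, b, h, heq⟩
      rw [heq]
      exact ⟨ι b, ⟨ι a, mk_mem_pushRel.2 (hι a), h⟩, mk_mem_pushRel.2 (hι b)⟩
    · rintro ⟨v, ⟨u, ⟨a, a', h₁, heq⟩, h₂⟩, b, b', h₃, heq'⟩
      simp only [Prod.mk.injEq] at heq heq'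
      obtain ⟨rfl, rfl⟩ := heq
      obtain ⟨rfl, rfl⟩ := heq'
      exact mk_mem_pushRel.2 (htrans (htrans h₁ h₂) h₃)

/-- Representatives of the conjugacy classes of partial orders on a finite set. -/
theorem exists_orderRel_reps (E : Type) [Finite E] :
    ∃ (m : ℕ) (Rs : Fin m → Set (E × E)), (∀ i, IsOrderRel (Rs i)) ∧
      (∀ i j, (∃ σ : Equiv.Perm E, conjRel σ (Rs i) = Rs j) → i = j) ∧
      ∀ R, IsOrderRel R → ∃ (i : Fin m) (σ : Equiv.Perm E), conjRel σ (Rs i) = R := by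
  let r : Setoid {R : Set (E × E) // IsOrderRel R} :=
    { r := fun R S => ∃ σ : Equiv.Perm E, conjRel σ R.1 = S.1
      iseqv :=
        { refl := fun R => ⟨1, conjRel_one _⟩
          symm := by
            rintro R S ⟨σ, h⟩
            exact ⟨σ⁻¹, by rw [← h, ← conjRel_mul, inv_mul_cancel, conjRel_one]⟩
          trans := by
            rintro R S T ⟨σ, h⟩ ⟨τ, h'⟩
            exact ⟨τ * σ, by rw [conjRel_mul, h, h']⟩ } }
  let ε := Finite.equivFin (Quotient r)
  refine ⟨Nat.card (Quotient r), fun i => (ε.symm i).out.1, fun i => (ε.symm i).out.2,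
    fun i j h => ?_, fun R hR => ?_⟩
  · refine ε.symm.injective ?_
    rw [← Quotient.out_eq (ε.symm i), ← Quotient.out_eq (ε.symm j)]
    exact Quotient.sound h
  · refine ⟨ε (Quotient.mk r ⟨R, hR⟩), ?_⟩
    simp only [Equiv.symm_apply_apply]
    exact Quotient.mk_out (s := r) ⟨R, hR⟩

end Relations

section Assembly

/-- The quotients by a family of representatives form a family of representatives of the
isomorphism classes of simple modules. -/
theorem IsSimpleReps.moduleCat {A : Type} [Ring A] {κ : Type*} {L : κ → Submodule A A}
    (hL : IsSimpleReps L) :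
    (∀ i, IsSimpleModule A (ModuleCat.of A (A ⧸ L i))) ∧
      (∀ i j, Nonempty (ModuleCat.of A (A ⧸ L i) ≅ ModuleCat.of A (A ⧸ L j)) → i = j) ∧
      ∀ V : ModuleCat.{0} A, IsSimpleModule A V →
        ∃ i, Nonempty (V ≅ ModuleCat.of A (A ⧸ L i)) := by
  refine ⟨fun i => isSimpleModule_iff_isCoatom.2 (hL.isCoatom i), fun i j h => ?_, fun V hV => ?_⟩
  · obtain ⟨φ⟩ := h
    obtain ⟨s, hs, hst⟩ :=
      (nonempty_quotient_linearEquiv_iff (hL.isCoatom i) (hL.isCoatom j)).1 ⟨φ.toLinearEquiv⟩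
    exact hL.injective i j s hs hst
  · obtain ⟨I, hI, ⟨φ⟩⟩ := isSimpleModule_iff_quot_maximal.1 hV
    obtain ⟨i, hi⟩ := hL.exists_rep I hI.out
    obtain ⟨ψ⟩ := (nonempty_quotient_linearEquiv_iff (hL.isCoatom i) hI.out).2 hi
    exact ⟨i, ⟨(φ.trans ψ.symm).toModuleIso⟩⟩

/-- The simple modules over the algebra of relations on `X` are parametrized by the pairs of an
isomorphism class of posets of cardinality at most `|X|` and a simple module over the algebra of
its automorphism group. -/
theorem exists_isSimpleReps_relAlgebra (k : Type) [Field k] [IsAlgClosed k] [CharZero k]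
    {X : Type} [Finite X] {n : ℕ} (hn : Nat.card X = n) {m : ℕ → ℕ}
    {Rs : (e : ℕ) → Fin (m e) → Set (Fin e × Fin e)} (hR : ∀ e i, IsOrderRel (Rs e i))
    (hconj : ∀ e i j, (∃ σ : Equiv.Perm (Fin e), conjRel σ (Rs e i) = Rs e j) → i = j)
    (hsurj : ∀ e R, IsOrderRel R →
      ∃ (i : Fin (m e)) (σ : Equiv.Perm (Fin e)), conjRel σ (Rs e i) = R) :
    ∃ L : (Σ p : Σ e : Fin (n + 1), Fin (m e),
        Fin (Nat.card (ConjClasses (autRel (Fin p.1) (Rs p.1 p.2))))) →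
          Submodule (MonoidAlgebra k (Set (X × X))) (MonoidAlgebra k (Set (X × X))),
      IsSimpleReps L := by
  let ι : (e : Fin (n + 1)) → Fin e ↪ X := fun e =>
    (Fin.castLEEmb (Nat.lt_succ_iff.1 e.2)).trans (Finite.equivFinOfCardEq hn).symm.toEmbedding
  choose L hL using fun p : Σ e : Fin (n + 1), Fin (m e) =>
    exists_isSimpleReps_monoidAlgebra_group k (autRel (Fin p.1) (Rs p.1 p.2))
  refine ⟨_, clifford_munn_ponizovskii (fun p => autHom (hR p.1 p.2) (ι p.1))
    (fun p => isMaximalSubgroup_autHom (hR p.1 p.2) (ι p.1)) ?_ ?_ L hL⟩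
  · rintro ⟨⟨e, he⟩, i⟩ ⟨⟨e', he'⟩, j⟩ h₁ h₂
    simp only [autHom_one] at h₁ h₂
    obtain ⟨σ, hσ⟩ := exists_equiv_of_pushRel_eq_mul (hR _ _) (hR _ _) _ _ h₁ h₂
    obtain rfl : e = e' := by simpa using Fintype.card_congr σ
    obtain rfl := hconj e i j ⟨σ, conjRel_eq_iff.2 hσ⟩
    rfl
  · intro f hf
    obtain ⟨E, κ, R, hER, ⟨a, b, hab⟩, c, d, hcd⟩ := exists_pushRel_of_mul_self_eq hf
    have : Finite E := Finite.of_injective κ κ.injective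
    have hle : Nat.card E < n + 1 := by
      rw [Nat.lt_succ_iff, ← hn]
      exact Nat.card_le_card_of_injective κ κ.injective
    let τ : E ≃ Fin (Nat.card E) := Finite.equivFin E
    obtain ⟨i, σ, hσ⟩ := hsurj (Nat.card E) {p | (τ.symm p.1, τ.symm p.2) ∈ R}
      ⟨fun _ => hER.1 _, fun _ _ h h' => τ.symm.injective (hER.2.1 _ _ h h'),
        fun _ _ _ => hER.2.2 _ _ _⟩
    rw [conjRel_eq_iff] at hσ
    have hσ' : ∀ x y, (x, y) ∈ Rs _ i ↔ ((σ.trans τ.symm) x, (σ.trans τ.symm) y) ∈ R := hσ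
    obtain ⟨t, t', ht⟩ := exists_pushRel_eq_mul (ι ⟨_, hle⟩) κ (σ.trans τ.symm) hσ'
    obtain ⟨u, u', hu⟩ := exists_pushRel_eq_mul (R := R) (S := Rs _ i) κ (ι ⟨_, hle⟩)
      (σ.trans τ.symm).symm (fun x y => by simp [hσ'])
    refine ⟨⟨⟨_, hle⟩, i⟩, ?_, ?_⟩ <;> simp only [autHom_one]
    · exact ⟨a * u, u' * b, by rw [hab, hu]; simp only [mul_assoc]⟩
    · exact ⟨t * c, d * t', by rw [ht, hcd]; simp only [mul_assoc]⟩

end Assembly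

open CategoryTheory in
/-- For an algebraically closed field `k` of characteristic zero and a finite set `X` with
`|X| = n`, the number `N` of isomorphism classes of simple modules over the algebra of
relations `𝓡_X = k𝓒(X,X)` equals `Σ_{e=0}^{n} Σ_{[R]} c(Aut(E,R))`, where for each `e`
the relation `[R]` runs over a set of representatives of the `Σ_E`-conjugacy classes of
partial order relations on the `e`-element set `E = Fin e`, `Aut(E,R)` is the stabilizer
of `R` under the conjugation action, and `c(G)` is the number of conjugacy classes of `G`. -/
theorem card_simple_modules_relAlgebra (k : Type) [Field k] [IsAlgClosed k] [CharZero k]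
    (X : Type) [Fintype X] (n : ℕ) (hn : Fintype.card X = n) :
    ∃ (N : ℕ) (M : Fin N → ModuleCat.{0} (MonoidAlgebra k (Set (X × X))))
      (m : ℕ → ℕ) (Rs : (e : ℕ) → Fin (m e) → Set (Fin e × Fin e)),
      -- the `M i` form a set of representatives of the isomorphism classes of
      -- simple `𝓡_X`-modules
      (∀ i, IsSimpleModule (MonoidAlgebra k (Set (X × X))) (M i)) ∧
      (∀ i j, Nonempty (M i ≅ M j) → i = j) ∧
      (∀ V : ModuleCat.{0} (MonoidAlgebra k (Set (X × X))),
        IsSimpleModule (MonoidAlgebra k (Set (X × X))) V → ∃ i, Nonempty (V ≅ M i)) ∧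
      -- for each `e ≤ n`, the `Rs e i` form a set of representatives of the
      -- `Σ_E`-conjugacy classes of partial order relations on `E = Fin e`
      (∀ e, e ≤ n → ∀ i, IsOrderRel (Rs e i)) ∧
      (∀ e, e ≤ n → ∀ i j, (∃ σ : Equiv.Perm (Fin e), conjRel σ (Rs e i) = Rs e j) → i = j) ∧
      (∀ e, e ≤ n → ∀ R : Set (Fin e × Fin e), IsOrderRel R →
        ∃ (i : Fin (m e)) (σ : Equiv.Perm (Fin e)), conjRel σ (Rs e i) = R) ∧
      -- the count
      N = ∑ e ∈ Finset.range (n + 1), ∑ i : Fin (m e),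
            Nat.card (ConjClasses (autRel (Fin e) (Rs e i))) := by
  choose m Rs hR hconj hsurj using fun e : ℕ => exists_orderRel_reps (Fin e)
  obtain ⟨L, hL⟩ :=
    exists_isSimpleReps_relAlgebra k (Nat.card_eq_fintype_card.trans hn) hR hconj hsurj
  let ε := Fintype.equivFin (Σ p : Σ e : Fin (n + 1), Fin (m e),
    Fin (Nat.card (ConjClasses (autRel (Fin p.1) (Rs p.1 p.2)))))
  obtain ⟨h₁, h₂, h₃⟩ := hL.moduleCat
  refine ⟨_, fun i => ModuleCat.of _ (_ ⧸ L (ε.symm i)), m, Rs, fun i => h₁ _,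
    fun i j h => ε.symm.injective (h₂ _ _ h), fun V hV => ?_, fun e _ => hR e,
    fun e _ => hconj e, fun e _ => hsurj e, ?_⟩
  · obtain ⟨i, hi⟩ := h₃ V hV
    obtain ⟨j, rfl⟩ := ε.symm.surjective i
    exact ⟨j, hi⟩
  · rw [Fintype.card_sigma, Fintype.sum_sigma, ← Fin.sum_univ_eq_sum_range
      (fun e => ∑ i : Fin (m e), Nat.card (ConjClasses (autRel (Fin e) (Rs e i))))]
    simp only [Fintype.card_fin]
end
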